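/- arXiv:cs/0110031 — 17 statements merged into one kernel-verified Lean document; each statement's English description precedes it below -/
import Mathlib

section
/- Let n ≥ 2 and suppose that over the field of real numbers the polynomial S_n^2(X) is computed by a (not necessarily homogeneous) ΣΠΣ arithmetic circuit with r multiplication gates, i.e. S_n^2(X) = Σ_{i=1}^r Π_{j=1}^{s_i} L_{ij}(X) where each L_{ij} is an affine linear form in X_1,…,X_n with real coefficients. Then r ≥ n − 1. -/
open MvPolynomial

/-- The second elementary symmetric polynomial `∑_{i < j} X_i X_j` in `n` variables. -/
noncomputable def esym2 (F : Type*) [CommRing F] (n : ℕ) : MvPolynomial (Fin n) F :=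
  ∑ p ∈ Finset.univ.filter (fun p : Fin n × Fin n => p.1 < p.2), X p.1 * X p.2

/-- Passing to the kernel of a functional drops the dimension of a subspace by at most one. -/
theorem finrank_le_finrank_inf_ker_add_one {E : Type*} [AddCommGroup E] [Module ℝ E]
    [FiniteDimensional ℝ E] (W : Submodule ℝ E) (f : E →ₗ[ℝ] ℝ) :
    Module.finrank ℝ W ≤ Module.finrank ℝ ↥(W ⊓ LinearMap.ker f) + 1 := by
  have hrank := LinearMap.finrank_range_add_finrank_ker (f.domRestrict W)
  have hrange : Module.finrank ℝ (LinearMap.range (f.domRestrict W)) ≤ 1 :=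
    (Submodule.finrank_le _).trans (Module.finrank_self ℝ).le
  have hker : (LinearMap.ker (f.domRestrict W)).map W.subtype = W ⊓ LinearMap.ker f := by
    ext x
    simp [and_comm]
  have hmap := Submodule.finrank_map_subtype_eq W (LinearMap.ker (f.domRestrict W))
  rw [hker] at hmap
  omega

/-- Given finitely many products of affine functionals, there is an affine subspace, of codimension
at most the number of products, on which all of them are constant. -/
theorem exists_affine_subspace_prod_const {E ι : Type*} [AddCommGroup E] [Module ℝ E]
    [FiniteDimensional ℝ E] {κ : ι → Type*} [∀ i, Fintype (κ i)]
    (c : (i : ι) → κ i → ℝ) (l : (i : ι) → κ i → E →ₗ[ℝ] ℝ) (S : Finset ι) :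
    ∃ (p : E) (W : Submodule ℝ E), Module.finrank ℝ E ≤ Module.finrank ℝ W + S.card ∧
      ∀ i ∈ S, ∀ w ∈ W, ∏ j, (c i j + l i j (p + w)) = ∏ j, (c i j + l i j p) := by
  classical
  induction S using Finset.induction_on with
  | empty => exact ⟨0, ⊤, by simp, by simp⟩
  | insert i S hi ih =>
    obtain ⟨p, W, hdim, hconst⟩ := ih
    rw [Finset.card_insert_of_notMem hi]
    by_cases hW : ∀ j, ∀ w ∈ W, l i j w = 0
    · refine ⟨p, W, by omega, ?_⟩
      intro k hk w hw
      rcases Finset.mem_insert.1 hk with rfl | hk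
      · exact Finset.prod_congr rfl fun j _ => by rw [map_add, hW j w hw, add_zero]
      · exact hconst k hk w hw
    · push Not at hW
      obtain ⟨j, v, hv, hlv⟩ := hW
      set u : E := (-(c i j + l i j p) / l i j v) • v with hu
      have huW : u ∈ W := W.smul_mem _ hv
      have hzero : c i j + l i j (p + u) = 0 := by
        rw [map_add, hu, map_smul, smul_eq_mul, div_mul_cancel₀ _ hlv]
        ring
      refine ⟨p + u, W ⊓ LinearMap.ker (l i j), ?_, ?_⟩
      · have := finrank_le_finrank_inf_ker_add_one W (l i j)
        omega
      · rintro k hk w ⟨hwW, hwker⟩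
        rcases Finset.mem_insert.1 hk with rfl | hk
        · have hwzero : c k j + l k j (p + u + w) = 0 := by
            rw [map_add, LinearMap.mem_ker.1 hwker, add_zero, hzero]
          rw [Finset.prod_eq_zero (Finset.mem_univ j) hwzero,
            Finset.prod_eq_zero (Finset.mem_univ j) hzero]
        · rw [add_assoc, hconst k hk _ (W.add_mem huW hwW), hconst k hk _ huW]

theorem two_mul_eval_esym2 (n : ℕ) (x : Fin n → ℝ) :
    2 * eval x (esym2 ℝ n) = (∑ i, x i) ^ 2 - ∑ i, x i ^ 2 := by
  have hlt : eval x (esym2 ℝ n) = ∑ i, ∑ j, if i < j then x i * x j else 0 := by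
    simp [esym2, map_sum, Finset.sum_filter, Fintype.sum_prod_type, apply_ite (eval x)]
  have hgt : eval x (esym2 ℝ n) = ∑ i, ∑ j, if j < i then x i * x j else 0 := by
    rw [hlt, Finset.sum_comm]
    simp only [mul_comm]
  have hdiag : ∑ i, x i ^ 2 = ∑ i, ∑ j, if i = j then x i * x j else 0 := by
    simp [sq]
  have hsq : (∑ i, x i) ^ 2 = ∑ i, ∑ j, x i * x j := by
    rw [sq, Finset.sum_mul_sum]
  rw [two_mul, eq_sub_iff_add_eq, hsq, hdiag]
  nth_rewrite 1 [hlt]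
  rw [hgt]
  simp only [← Finset.sum_add_distrib]
  refine Finset.sum_congr rfl fun i _ => Finset.sum_congr rfl fun j _ => ?_
  rcases lt_trichotomy i j with hij | rfl | hij
  · simp [hij, hij.not_gt, hij.ne]
  · simp
  · simp [hij, hij.not_gt, hij.ne']

/-- A subspace along which `esym2` is constant at some base point has dimension at most one. -/
theorem finrank_le_one_of_eval_esym2_const {n : ℕ} (p : Fin n → ℝ)
    (W : Submodule ℝ (Fin n → ℝ))
    (hW : ∀ w ∈ W, eval (p + w) (esym2 ℝ n) = eval p (esym2 ℝ n)) :
    Module.finrank ℝ W ≤ 1 := by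
  let f : (Fin n → ℝ) →ₗ[ℝ] ℝ := ∑ i, LinearMap.proj i
  have hf (x : Fin n → ℝ) : f x = ∑ i, x i := by simp [f]
  have hbot : W ⊓ LinearMap.ker f = ⊥ := by
    rw [eq_bot_iff]
    rintro w ⟨hw, hker⟩
    have hsum : ∑ i, w i = 0 := (hf w).symm.trans hker
    have hpos := two_mul_eval_esym2 n (p + w)
    have hneg := two_mul_eval_esym2 n (p + -w)
    have hbase := two_mul_eval_esym2 n p
    rw [hW w hw] at hpos
    rw [hW _ (W.neg_mem hw)] at hneg
    have hsq : ∑ i, (p + w) i ^ 2 + ∑ i, (p + -w) i ^ 2 - 2 * ∑ i, p i ^ 2 =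
        2 * ∑ i, w i ^ 2 := by
      simp only [Finset.mul_sum, ← Finset.sum_add_distrib, ← Finset.sum_sub_distrib]
      exact Finset.sum_congr rfl fun i _ => by simp only [Pi.add_apply, Pi.neg_apply]; ring
    have hsump : ∑ i, (p + w) i = ∑ i, p i := by simp [Finset.sum_add_distrib, hsum]
    have hsumn : ∑ i, (p + -w) i = ∑ i, p i := by simp [Finset.sum_add_distrib, hsum]
    rw [hsump] at hpos
    rw [hsumn] at hneg
    have hw0 : ∑ i, w i ^ 2 = 0 := by linarith
    rw [Finset.sum_eq_zero_iff_of_nonneg fun i _ => sq_nonneg (w i)] at hw0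
    exact (Submodule.mem_bot ℝ).2 <| funext fun i => pow_eq_zero_iff two_ne_zero |>.1
      (hw0 i (Finset.mem_univ i))
  have := finrank_le_finrank_inf_ker_add_one W f
  rwa [hbot, finrank_bot, zero_add] at this

/-- If a (possibly inhomogeneous) ΣΠΣ circuit with `r` multiplication gates computes
`S_n^2` over the reals, then `r ≥ n - 1`. -/
theorem stmt_0 (n r : ℕ) (hn : 2 ≤ n) (s : Fin r → ℕ)
    (c : (i : Fin r) → Fin (s i) → ℝ)
    (a : (i : Fin r) → Fin (s i) → Fin n → ℝ)
    (h : esym2 ℝ n =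
      ∑ i : Fin r, ∏ j : Fin (s i), (C (c i j) + ∑ k : Fin n, C (a i j k) * X k)) :
    n - 1 ≤ r := by
  obtain ⟨p, W, hdim, hconst⟩ := exists_affine_subspace_prod_const c
    (fun i j => ∑ k, a i j k • (LinearMap.proj k : (Fin n → ℝ) →ₗ[ℝ] ℝ)) Finset.univ
  have heval (x : Fin n → ℝ) : eval x (esym2 ℝ n) = ∑ i, ∏ j, (c i j +
      (∑ k, a i j k • (LinearMap.proj k : (Fin n → ℝ) →ₗ[ℝ] ℝ)) x) := by
    simp [h]
  have hone : Module.finrank ℝ W ≤ 1 := finrank_le_one_of_eval_esym2_const p W fun w hw => by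
    rw [heval, heval]
    exact Finset.sum_congr rfl fun i hi => hconst i hi w hw
  rw [Module.finrank_fin_fun, Finset.card_univ, Fintype.card_fin] at hdim
  omega
end

section
/- For every n ≥ 1, the polynomial S_n^2(X) over the field of complex numbers can be written as Σ_{i=1}^r L_i(X) R_i(X) where r = ⌈n/2⌉ and each L_i, R_i is a homogeneous linear form in X_1,…,X_n with complex coefficients; that is, S_n^2(X) can be computed over ℂ by a homogeneous ΣΠΣ circuit with ⌈n/2⌉ multiplication gates, each a product of two homogeneous linear forms. -/
open MvPolynomial

/-- Splitting off the first variable of the sum of pairwise products. -/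
theorem sum_pairs_succ {A : Type*} [CommRing A] (n : ℕ) (x : Fin (n + 1) → A) :
    ∑ p ∈ Finset.univ.filter (fun p : Fin (n + 1) × Fin (n + 1) => p.1 < p.2), x p.1 * x p.2 =
      x 0 * ∑ i : Fin n, x i.succ +
        ∑ p ∈ Finset.univ.filter (fun p : Fin n × Fin n => p.1 < p.2),
          x p.1.succ * x p.2.succ := by
  simp [Finset.sum_filter, Fintype.sum_prod_type, Fin.sum_univ_succ, Finset.mul_sum]

/-- The scalars `c k = -k / (2k - 1)` satisfy the recursion obtained by completing the square in
`ab + (a + b)t + c (a + b + t)²` with respect to `a` and `b`: up to `c (k + 1) t²`, this form is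
the product of two linear forms. -/
theorem exists_factor_coeffs (k : ℕ) :
    ∃ s g : ℂ, s ^ 2 = 1 + 4 * (-k / (2 * k - 1)) ∧ g * s = 2 * (1 + 2 * (-k / (2 * k - 1))) ∧
      -((k + 1 : ℕ) : ℂ) / (2 * (k + 1 : ℕ) - 1) = -k / (2 * k - 1) - g ^ 2 / 4 := by
  have hk : (2 * k - 1 : ℂ) ≠ 0 := by
    intro h
    have h' : ((2 * k : ℕ) : ℂ) = (1 : ℕ) := by push_cast; linear_combination h
    have := Nat.cast_injective h'
    omega
  have hk' : (2 * k + 1 : ℂ) ≠ 0 := by exact_mod_cast (2 * k).succ_ne_zero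
  rw [Nat.cast_succ, show (2 * (k + 1) - 1 : ℂ) = 2 * k - 1 + 2 by ring]
  rw [show (2 * k + 1 : ℂ) = 2 * k - 1 + 2 by ring] at hk'
  obtain ⟨d, hd⟩ : ∃ d : ℂ, 2 * k - 1 = d := ⟨_, rfl⟩
  have hkd : (k : ℂ) = (d + 1) / 2 := by linear_combination hd / 2
  rw [hd] at hk hk' ⊢
  rw [hkd]
  have hq : 1 + 4 * (-((d + 1) / 2) / d) = -(d + 2) / d := by
    field_simp
    ring
  obtain ⟨s, hs⟩ := IsAlgClosed.exists_pow_nat_eq (-(d + 2) / d) two_pos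
  have hs0 : s ≠ 0 := by
    rintro rfl
    exact div_ne_zero (neg_ne_zero.mpr hk') hk (by simpa using hs.symm)
  refine ⟨s, 2 * (1 + 2 * (-((d + 1) / 2) / d)) / s, hs.trans hq.symm,
    div_mul_cancel₀ _ hs0, ?_⟩
  rw [div_pow, hs]
  field_simp
  ring

/-- `S_n^2 + c k (∑ x_i)²` is a sum of `⌈n/2⌉` products of linear forms. -/
theorem exists_sum_mul_eq_pairs_add_sq (σ : Type*) (n : ℕ) : ∀ k : ℕ,
    ∃ L R : Fin ((n + 1) / 2) → Fin n → ℂ, ∀ x : Fin n → MvPolynomial σ ℂ,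
      ∑ p ∈ Finset.univ.filter (fun p : Fin n × Fin n => p.1 < p.2), x p.1 * x p.2 +
          C (-k / (2 * k - 1) : ℂ) * (∑ i, x i) ^ 2 =
        ∑ i, (∑ j, C (L i j) * x j) * (∑ j, C (R i j) * x j) := by
  induction n using Nat.twoStepInduction with
  | zero => exact fun k => ⟨0, 0, fun x => by simp⟩
  | one =>
    refine fun k => ⟨fun _ _ => -k / (2 * k - 1), fun _ _ => 1, fun x => ?_⟩
    simp [Finset.sum_filter, Fintype.sum_prod_type]
    ring
  | more n ih _ =>
    intro k
    obtain ⟨L, R, h⟩ := ih (k + 1)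
    obtain ⟨s, g, hs, hg, hc⟩ := exists_factor_coeffs k
    rw [hc] at h
    generalize (-k / (2 * k - 1) : ℂ) = c at *
    rw [show (n + 2 + 1) / 2 = (n + 1) / 2 + 1 by omega]
    refine ⟨Fin.cons (Fin.cons ((s - 1) / 4) (Fin.cons ((s + 1) / 4) fun _ => g / 4))
        fun i => Fin.cons 0 (Fin.cons 0 (L i)),
      Fin.cons (Fin.cons (s + 1) (Fin.cons (s - 1) fun _ => g))
        fun i => Fin.cons 0 (Fin.cons 0 (R i)), fun x => ?_⟩
    have hx := h fun i => x i.succ.succ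
    rw [sum_pairs_succ, sum_pairs_succ n fun i => x i.succ]
    simp only [Fin.sum_univ_succ, Fin.cons_zero, Fin.cons_succ, map_zero, zero_mul, zero_add,
      ← Finset.mul_sum]
    rw [← hx]
    have hs' := congrArg (C (σ := σ)) hs
    have hg' := congrArg (C (σ := σ)) hg
    have h4 : (C (σ := σ) (4⁻¹ : ℂ)) * 4 = 1 := by
      rw [← map_ofNat (C (σ := σ) (R := ℂ)) 4, ← map_mul]
      norm_num
    simp only [div_eq_mul_inv, map_mul, map_add, map_sub, map_pow, map_one, map_ofNat] at hs' hg' ⊢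
    generalize ∑ i : Fin n, x i.succ.succ = t
    generalize x 0 = a
    generalize x (Fin.succ 0) = b
    linear_combination -C 4⁻¹ * (a + b) ^ 2 * hs' - 2 * C 4⁻¹ * (a + b) * t * hg' -
      (a * b + (a + b) * t + C c * (a + b + t) ^ 2 - C c * t ^ 2) * h4

/-- Over ℂ, `S_n^2` can be computed by a homogeneous ΣΠΣ circuit with `⌈n/2⌉`
multiplication gates, each a product of two homogeneous linear forms. -/
theorem stmt_1 (n : ℕ) (hn : 1 ≤ n) :
    ∃ L R : Fin ((n + 1) / 2) → Fin n → ℂ,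
      esym2 ℂ n =
        ∑ i : Fin ((n + 1) / 2),
          (∑ k : Fin n, C (L i k) * X k) * (∑ k : Fin n, C (R i k) * X k) := by
  obtain ⟨L, R, h⟩ := exists_sum_mul_eq_pairs_add_sq (Fin n) n 0
  exact ⟨L, R, by simpa [esym2] using h X⟩
end

section
/- Let n ≥ 2 and suppose that over the field GF(2) the polynomial S_n^2(X) equals Σ_{i=1}^r Π_{j=1}^{s_i} L_{ij}(X), where each L_{ij} is an affine linear form in X_1,…,X_n over GF(2). If n ≡ 0, 2 or 3 (mod 4) then r ≥ ⌈n/2⌉, and if n ≡ 1 (mod 4) then r ≥ ⌊n/2⌋. -/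
open MvPolynomial

/-- A double sum splits into its diagonal and its symmetrized strictly upper triangle. -/
lemma sum_sum_eq_sum_lt_add_sum_diag {R : Type*} [AddCommMonoid R] {n : ℕ}
    (f : Fin n → Fin n → R) :
    ∑ i, ∑ j, f i j =
      ∑ p ∈ Finset.univ.filter (fun p : Fin n × Fin n => p.1 < p.2), (f p.1 p.2 + f p.2 p.1) +
        ∑ i, f i i := by
  have hgt : ∑ p ∈ Finset.univ.filter (fun p : Fin n × Fin n => p.1 < p.2), f p.2 p.1 =
      ∑ i, ∑ j, if j < i then f i j else 0 := by
    rw [Finset.sum_filter, Fintype.sum_prod_type, Finset.sum_comm]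
  have hlt : ∑ p ∈ Finset.univ.filter (fun p : Fin n × Fin n => p.1 < p.2), f p.1 p.2 =
      ∑ i, ∑ j, if i < j then f i j else 0 := by
    rw [Finset.sum_filter, Fintype.sum_prod_type]
  have hdiag : ∑ i, f i i = ∑ i, ∑ j, if i = j then f i j else 0 := by
    simp
  rw [Finset.sum_add_distrib, hgt, hlt, hdiag]
  simp only [← Finset.sum_add_distrib]
  refine Finset.sum_congr rfl fun i _ => Finset.sum_congr rfl fun j _ => ?_
  rcases lt_trichotomy i j with h | h | h
  · simp [h, h.not_gt, h.ne]
  · simp [h]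
  · simp [h, h.not_gt, h.ne']

/-- The value of the second elementary symmetric polynomial at a point. -/
def esym2Val {R : Type*} [CommRing R] {n : ℕ} (x : Fin n → R) : R :=
  ∑ p ∈ Finset.univ.filter (fun p : Fin n × Fin n => p.1 < p.2), x p.1 * x p.2

/-- The polar form `(∑ xᵢ) (∑ yᵢ) - ∑ xᵢ yᵢ` of the second elementary symmetric polynomial. -/
def esym2Polar (R : Type*) [CommRing R] (n : ℕ) : LinearMap.BilinForm R (Fin n → R) :=
  LinearMap.mk₂ R (fun x y => (∑ i, x i) * (∑ i, y i) - ∑ i, x i * y i)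
    (fun x x' y => by simp only [Pi.add_apply, add_mul, Finset.sum_add_distrib]; ring)
    (fun t x y => by
      simp only [Pi.smul_apply, smul_eq_mul, mul_assoc, ← Finset.mul_sum]; ring)
    (fun x y y' => by simp only [Pi.add_apply, mul_add, Finset.sum_add_distrib]; ring)
    (fun t x y => by
      simp only [Pi.smul_apply, smul_eq_mul, mul_left_comm _ t, ← Finset.mul_sum]; ring)

lemma esym2Polar_apply {R : Type*} [CommRing R] {n : ℕ} (x y : Fin n → R) :
    esym2Polar R n x y = (∑ i, x i) * (∑ i, y i) - ∑ i, x i * y i := rfl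

lemma esym2Polar_isRefl (R : Type*) [CommRing R] (n : ℕ) : (esym2Polar R n).IsRefl := by
  intro x y hxy
  rw [esym2Polar_apply] at hxy ⊢
  rw [mul_comm, ← hxy]
  simp only [mul_comm]

lemma esym2Val_add {R : Type*} [CommRing R] {n : ℕ} (x y : Fin n → R) :
    esym2Val (x + y) = esym2Val x + esym2Val y + esym2Polar R n x y := by
  have h : esym2Polar R n x y =
      ∑ p ∈ Finset.univ.filter (fun p : Fin n × Fin n => p.1 < p.2),
        (x p.1 * y p.2 + x p.2 * y p.1) := by
    rw [esym2Polar_apply, Finset.sum_mul_sum, sum_sum_eq_sum_lt_add_sum_diag, add_sub_cancel_right]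
  rw [h, esym2Val, esym2Val, esym2Val, ← Finset.sum_add_distrib, ← Finset.sum_add_distrib]
  refine Finset.sum_congr rfl fun p _ => ?_
  simp only [Pi.add_apply]
  ring

lemma esym2Val_smul {R : Type*} [CommRing R] {n : ℕ} (t : R) (x : Fin n → R) :
    esym2Val (t • x) = t ^ 2 * esym2Val x := by
  rw [esym2Val, esym2Val, Finset.mul_sum]
  refine Finset.sum_congr rfl fun p _ => ?_
  simp only [Pi.smul_apply, smul_eq_mul]
  ring

lemma map_esym2Val {R S : Type*} [CommRing R] [CommRing S] (f : R →+* S) {n : ℕ}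
    (x : Fin n → R) : esym2Val (fun i => f (x i)) = f (esym2Val x) := by
  simp [esym2Val]

lemma aeval_esym2 {R S : Type*} [CommRing R] [CommRing S] [Algebra R S] {n : ℕ}
    (x : Fin n → S) : aeval x (esym2 R n) = esym2Val x := by
  simp [esym2, esym2Val]

lemma esym2Val_one_of_mod_four_eq_three {n : ℕ} (hn : n % 4 = 3) :
    esym2Val (1 : Fin n → ZMod 2) = 1 := by
  have h := sum_sum_eq_sum_lt_add_sum_diag (fun _ _ : Fin n => (1 : ℕ))
  simp only [Finset.sum_const, Finset.card_univ, Fintype.card_fin, smul_eq_mul, mul_one] at h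
  simp only [esym2Val, Pi.one_apply, mul_one, Finset.sum_const, nsmul_eq_mul]
  generalize (Finset.univ.filter (fun p : Fin n × Fin n => p.1 < p.2)).card = m at h ⊢
  obtain ⟨q, rfl⟩ : ∃ q, n = 4 * q + 3 := ⟨n / 4, by omega⟩
  have hm : m = 2 * (4 * q ^ 2 + 5 * q + 1) + 1 := by nlinarith
  rw [hm]
  push_cast
  rw [show (2 : ZMod 2) = 0 from rfl]
  ring

/-- A vector in the radical of the polar form is constant, with value the sum of its entries. -/
lemma apply_eq_sum_of_mem_radical {R : Type*} [CommRing R] {n : ℕ} {x : Fin n → R}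
    (hx : x ∈ (esym2Polar R n).orthogonal ⊤) (k : Fin n) : x k = ∑ i, x i := by
  have h := (esym2Polar_isRefl R n) _ _
    (LinearMap.BilinForm.mem_orthogonal_iff.1 hx (Pi.single k 1) trivial)
  rw [esym2Polar_apply] at h
  simpa [Pi.single_apply, sub_eq_zero, eq_comm] using h

/-- The dimension bound for subspaces on which the second elementary symmetric polynomial
vanishes. -/
lemma two_mul_finrank_le_of_esym2Val_eq_zero {n : ℕ} (W : Submodule (ZMod 2) (Fin n → ZMod 2))
    (hW : ∀ w ∈ W, esym2Val w = 0) :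
    2 * Module.finrank (ZMod 2) W ≤ n + if n % 4 = 1 then 1 else 0 := by
  set B := esym2Polar (ZMod 2) n with hB
  have hle : W ≤ B.orthogonal W := by
    intro x hx
    rw [LinearMap.BilinForm.mem_orthogonal_iff]
    intro y hy
    have h := esym2Val_add y x
    rw [hW _ (W.add_mem hy hx), hW _ hx, hW _ hy, zero_add, zero_add] at h
    exact h.symm
  have hdim := LinearMap.BilinForm.finrank_add_finrank_orthogonal (esym2Polar_isRefl (ZMod 2) n) W
  rw [← hB, Module.finrank_fin_fun] at hdim
  have hmono := Submodule.finrank_mono hle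
  suffices hrad : Module.finrank (ZMod 2) ↥(W ⊓ B.orthogonal ⊤) ≤ if n % 4 = 1 then 1 else 0 by
    omega
  have hconst : ∀ x ∈ W ⊓ B.orthogonal ⊤, x = (∑ i, x i) • (1 : Fin n → ZMod 2) := by
    intro x hx
    ext k
    simpa using apply_eq_sum_of_mem_radical hx.2 k
  split_ifs with hn
  · calc
      _ ≤ Module.finrank (ZMod 2) ↥(Submodule.span (ZMod 2) {(1 : Fin n → ZMod 2)}) :=
        Submodule.finrank_mono fun x hx =>
          Submodule.mem_span_singleton.2 ⟨_, (hconst x hx).symm⟩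
      _ ≤ 1 := (finrank_span_le_card _).trans (by simp)
  · rw [Nat.le_zero, Submodule.finrank_eq_zero, Submodule.eq_bot_iff]
    intro x hx
    suffices hsum : ∑ i, x i = 0 by rw [hconst x hx, hsum, zero_smul]
    rcases Nat.even_or_odd n with heven | hodd
    · have hn2 : (n : ZMod 2) = 0 := (ZMod.natCast_eq_zero_iff_even).2 heven
      calc
        ∑ i, x i = ∑ _k : Fin n, ∑ i, x i :=
          Finset.sum_congr rfl fun k _ => apply_eq_sum_of_mem_radical hx.2 k
        _ = 0 := by simp [hn2]
    · have hn3 : n % 4 = 3 := by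
        have := Nat.odd_iff.1 hodd
        omega
      have h0 := hW x hx.1
      rw [hconst x hx, esym2Val_smul, esym2Val_one_of_mod_four_eq_three hn3, mul_one] at h0
      exact pow_eq_zero_iff two_ne_zero |>.1 h0

/-- Given `r` families of affine forms, there is an affine subspace `v + W` of codimension at most
`r` on which every family either contains an identically vanishing form or consists of constant
forms. -/
lemma exists_affine_subspace_forall_vanish_or_const {F V ι : Type*} [Field F] [AddCommGroup V]
    [Module F V] [FiniteDimensional F V] {κ : ι → Type*}
    (c : (i : ι) → κ i → F) (l : (i : ι) → κ i → Module.Dual F V) (t : Finset ι) :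
    ∃ (v : V) (W : Submodule F V), Module.finrank F V ≤ Module.finrank F W + t.card ∧
      ∀ i ∈ t, (∃ j, c i j + l i j v = 0 ∧ ∀ w ∈ W, l i j w = 0) ∨
        ∀ j, ∀ w ∈ W, l i j w = 0 := by
  classical
  induction t using Finset.induction_on with
  | empty => exact ⟨0, ⊤, by simp, by simp⟩
  | insert i t hi ih =>
    obtain ⟨v, W, hdim, hvW⟩ := ih
    rw [Finset.card_insert_of_notMem hi]
    by_cases hc : ∀ j, ∀ w ∈ W, l i j w = 0
    · refine ⟨v, W, by omega, fun k hk => ?_⟩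
      rcases Finset.mem_insert.1 hk with rfl | hk
      · exact Or.inr hc
      · exact hvW k hk
    push Not at hc
    obtain ⟨j, w, hw, hne⟩ := hc
    refine ⟨v - ((c i j + l i j v) / l i j w) • w, W ⊓ (l i j).ker, ?_, fun k hk => ?_⟩
    · have hsum := Submodule.finrank_sup_add_finrank_inf_eq W (l i j).ker
      have hker := (l i j).finrank_range_add_finrank_ker
      have hrange := (l i j).range.finrank_le
      rw [Module.finrank_self] at hrange
      have hsup := (W ⊔ (l i j).ker).finrank_le
      omega
    · rcases Finset.mem_insert.1 hk with rfl | hk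
      · refine Or.inl ⟨j, ?_, fun u hu => hu.2⟩
        rw [map_sub, map_smul, smul_eq_mul, div_mul_cancel₀ _ hne]
        ring
      · rcases hvW k hk with ⟨m, hm, hmW⟩ | hkW
        · refine Or.inl ⟨m, ?_, fun u hu => hmW u hu.1⟩
          rw [map_sub, map_smul, hmW w hw, smul_zero, sub_zero, hm]
        · exact Or.inr fun m u hu => hkW m u hu.1

/-- The substitution `x = v + T w` extracts `S_n^2(w)` as the coefficient of `T ^ 2`. -/
lemma coeff_two_aeval_line_esym2 {R : Type*} [CommRing R] {n : ℕ} (v w : Fin n → R) :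
    (aeval (fun k => Polynomial.C (v k) + Polynomial.X * Polynomial.C (w k))
      (esym2 R n)).coeff 2 = esym2Val w := by
  have hline : (fun k => Polynomial.C (v k) + Polynomial.X * Polynomial.C (w k)) =
      (fun k => Polynomial.C (v k)) + (Polynomial.X : Polynomial R) •
        (fun k => Polynomial.C (w k)) := rfl
  have hpolar : esym2Polar (Polynomial R) n (fun k => Polynomial.C (v k))
      (fun k => Polynomial.C (w k)) = Polynomial.C (esym2Polar R n v w) := by
    simp [esym2Polar_apply]
  rw [aeval_esym2, hline, esym2Val_add, esym2Val_smul, map_esym2Val, map_esym2Val, map_smul,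
    hpolar, smul_eq_mul]
  simp

lemma aeval_line_affine {R : Type*} [CommRing R] {n : ℕ} (v w a : Fin n → R) (c : R) :
    aeval (fun k => Polynomial.C (v k) + Polynomial.X * Polynomial.C (w k))
      (C c + ∑ k : Fin n, C (a k) * X k) =
      Polynomial.C (c + a ⬝ᵥ v) + Polynomial.X * Polynomial.C (a ⬝ᵥ w) := by
  simp only [map_add, map_sum, map_mul, aeval_X, aeval_C, Polynomial.algebraMap_eq, dotProduct,
    mul_add, Finset.sum_add_distrib, Finset.mul_sum, mul_left_comm]
  ring

/-- If a (possibly inhomogeneous) ΣΠΣ circuit with `r` multiplication gates computes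
`S_n^2` over GF(2), then `r ≥ ⌈n/2⌉` when `n ≡ 0, 2, 3 (mod 4)` and
`r ≥ ⌊n/2⌋` when `n ≡ 1 (mod 4)`. -/
theorem stmt_3 (n r : ℕ) (hn : 2 ≤ n) (s : Fin r → ℕ)
    (c : (i : Fin r) → Fin (s i) → ZMod 2)
    (a : (i : Fin r) → Fin (s i) → Fin n → ZMod 2)
    (h : esym2 (ZMod 2) n =
      ∑ i : Fin r, ∏ j : Fin (s i), (C (c i j) + ∑ k : Fin n, C (a i j k) * X k)) :
    ((n % 4 = 0 ∨ n % 4 = 2 ∨ n % 4 = 3) → (n + 1) / 2 ≤ r) ∧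
    (n % 4 = 1 → n / 2 ≤ r) := by
  obtain ⟨v, W, hdim, hvW⟩ := exists_affine_subspace_forall_vanish_or_const c
    (fun i j => dotProductBilin (ZMod 2) (ZMod 2) (a i j)) Finset.univ
  have hW : ∀ w ∈ W, esym2Val w = 0 := by
    intro w hw
    rw [← coeff_two_aeval_line_esym2 v w, h, map_sum, Polynomial.finsetSum_coeff]
    refine Finset.sum_eq_zero fun i _ => ?_
    simp only [map_prod, aeval_line_affine]
    rcases hvW i (Finset.mem_univ i) with ⟨j, hj, hjW⟩ | hconst
    · have hjw : a i j ⬝ᵥ w = 0 := hjW w hw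
      have hjv : c i j + a i j ⬝ᵥ v = 0 := hj
      rw [Finset.prod_eq_zero (Finset.mem_univ j) (by simp [hjw, hjv]), Polynomial.coeff_zero]
    · have hjw : ∀ j, a i j ⬝ᵥ w = 0 := fun j => hconst j w hw
      simp only [hjw, map_zero, mul_zero, add_zero, ← map_prod]
      exact Polynomial.coeff_C_of_ne_zero two_ne_zero
  have hbound := two_mul_finrank_le_of_esym2Val_eq_zero W hW
  rw [Module.finrank_fin_fun, Finset.card_univ, Fintype.card_fin] at hdim
  split_ifs at hbound <;> omega
end

section
/- For each residue c ∈ {0, 2, 3} there are infinitely many n with n ≡ c (mod 4) such that S_n^2(X) over GF(2) can be written as Σ_{i=1}^{⌈n/2⌉} L_i(X) R_i(X) with L_i, R_i homogeneous linear forms in X_1,…,X_n over GF(2); moreover there are infinitely many n with n ≡ 1 (mod 4) such that S_n^2(X) over GF(2) can be written as Σ_{i=1}^{⌊n/2⌋} L_i(X) R_i(X) with L_i, R_i homogeneous linear forms over GF(2). -/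
open MvPolynomial

/-- `p` is a sum of `r` products of pairs of elements of the submodule `M`. -/
def IsSumOfProducts {F A : Type*} [CommSemiring F] [CommSemiring A] [Algebra F A]
    (M : Submodule F A) (r : ℕ) (p : A) : Prop :=
  ∃ L R : Fin r → A, (∀ i, L i ∈ M) ∧ (∀ i, R i ∈ M) ∧ p = ∑ i, L i * R i

theorem isSumOfProducts_zero {F A : Type*} [CommSemiring F] [CommSemiring A] [Algebra F A]
    (M : Submodule F A) : IsSumOfProducts M 0 0 :=
  ⟨0, 0, fun i => i.elim0, fun i => i.elim0, by simp⟩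

theorem IsSumOfProducts.add_mul {F A : Type*} [CommSemiring F] [CommSemiring A] [Algebra F A]
    {M : Submodule F A} {r : ℕ} {p l m : A} (h : IsSumOfProducts M r p)
    (hl : l ∈ M) (hm : m ∈ M) : IsSumOfProducts M (r + 1) (p + l * m) := by
  obtain ⟨L, R, hL, hR, rfl⟩ := h
  refine ⟨Fin.snoc L l, Fin.snoc R m, fun i => ?_, fun i => ?_, ?_⟩
  · refine Fin.lastCases ?_ (fun i => ?_) i <;> simp [hl, hL]
  · refine Fin.lastCases ?_ (fun i => ?_) i <;> simp [hm, hR]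
  · simp [Fin.sum_univ_castSucc]

/-- The second elementary symmetric function of the first `n` terms of a sequence. -/
def seqEsym2 {A : Type*} [CommSemiring A] (x : ℕ → A) (n : ℕ) : A :=
  ∑ j ∈ Finset.range n, (∑ i ∈ Finset.range j, x i) * x j

theorem seqEsym2_succ {A : Type*} [CommSemiring A] (x : ℕ → A) (n : ℕ) :
    seqEsym2 x (n + 1) = seqEsym2 x n + (∑ i ∈ Finset.range n, x i) * x n :=
  Finset.sum_range_succ _ _

theorem seqEsym2_eq_of_le {A : Type*} [CommSemiring A] {x : ℕ → A} {n m : ℕ}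
    (hx : ∀ i, n ≤ i → x i = 0) (h : n ≤ m) : seqEsym2 x m = seqEsym2 x n := by
  induction m, h using Nat.le_induction with
  | base => rfl
  | succ m hm ih => rw [seqEsym2_succ, hx m hm, mul_zero, add_zero, ih]

/-- In characteristic two, adjoining eight variables to the second elementary symmetric
function of variables with sum `s` costs four products. -/
theorem esym2_adjoin_eight {A : Type*} [CommRing A] [CharP A 2]
    (s a b c d e f g h : A) :
    s * a + (s + a) * b + (s + a + b) * c + (s + a + b + c) * d + (s + a + b + c + d) * e
      + (s + a + b + c + d + e) * f + (s + a + b + c + d + e + f) * g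
      + (s + a + b + c + d + e + f + g) * h =
    (b + c + d + e) * (s + a + e + f) + (a + c + d + f) * (s + c + d + f)
      + (s + a + b + c) * (s + a + b + d)
      + (s + a + b + c + d + e + f + g) * (s + a + b + c + d + e + f + h) := by
  grind

theorem isSumOfProducts_seqEsym2 {F A : Type*} [CommSemiring F] [CommRing A] [Algebra F A]
    [CharP A 2] {M : Submodule F A} {x : ℕ → A} (hx : ∀ i, x i ∈ M) (k : ℕ) :
    IsSumOfProducts M (4 * k) (seqEsym2 x (8 * k + 1)) := by
  induction k with
  | zero => simpa [seqEsym2] using isSumOfProducts_zero M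
  | succ k ih =>
    have hs : ∑ i ∈ Finset.range (8 * k + 1), x i ∈ M := M.sum_mem fun i _ => hx i
    have key := esym2_adjoin_eight (∑ i ∈ Finset.range (8 * k + 1), x i)
      (x (8 * k + 1)) (x (8 * k + 2)) (x (8 * k + 3)) (x (8 * k + 4)) (x (8 * k + 5))
      (x (8 * k + 6)) (x (8 * k + 7)) (x (8 * k + 8))
    have hstep : seqEsym2 x (8 * (k + 1) + 1) = seqEsym2 x (8 * k + 1) + _ :=
      Eq.trans (by
        rw [show 8 * (k + 1) + 1 = 8 * k + 8 + 1 by ring]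
        rw [seqEsym2_succ x (8 * k + 8), seqEsym2_succ x (8 * k + 7),
          seqEsym2_succ x (8 * k + 6), seqEsym2_succ x (8 * k + 5),
          seqEsym2_succ x (8 * k + 4), seqEsym2_succ x (8 * k + 3),
          seqEsym2_succ x (8 * k + 2), seqEsym2_succ x (8 * k + 1)]
        rw [Finset.sum_range_succ x (8 * k + 7), Finset.sum_range_succ x (8 * k + 6),
          Finset.sum_range_succ x (8 * k + 5), Finset.sum_range_succ x (8 * k + 4),
          Finset.sum_range_succ x (8 * k + 3), Finset.sum_range_succ x (8 * k + 2),
          Finset.sum_range_succ x (8 * k + 1)]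
        simp only [add_assoc]) (congrArg (seqEsym2 x (8 * k + 1) + ·) key)
    rw [hstep, ← add_assoc, ← add_assoc, ← add_assoc]
    refine (((ih.add_mul ?_ ?_).add_mul ?_ ?_).add_mul ?_ ?_).add_mul ?_ ?_ <;>
      repeat' first | exact hs | exact hx _ | apply M.add_mem

/-- The variables `X 0, …, X (n - 1)`, extended by zero to a sequence. -/
noncomputable def varSeq (F : Type*) [CommSemiring F] (n i : ℕ) : MvPolynomial (Fin n) F :=
  if h : i < n then X ⟨i, h⟩ else 0

theorem varSeq_mem_span (F : Type*) [CommSemiring F] (n i : ℕ) :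
    varSeq F n i ∈ Submodule.span F (Set.range (X : Fin n → MvPolynomial (Fin n) F)) := by
  unfold varSeq
  split_ifs with h
  · exact Submodule.subset_span ⟨_, rfl⟩
  · exact Submodule.zero_mem _

theorem varSeq_eq_zero (F : Type*) [CommSemiring F] {n i : ℕ} (h : n ≤ i) :
    varSeq F n i = 0 :=
  dif_neg h.not_gt

theorem esym2_eq_seqEsym2 (F : Type*) [CommRing F] (n : ℕ) :
    esym2 F n = seqEsym2 (varSeq F n) n := by
  have hinner (j : Fin n) : ∑ i ∈ Finset.range j, varSeq F n i =
      ∑ i : Fin n, if i < j then X i else 0 := by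
    have hX (i : Fin n) : (if i < j then X i else 0 : MvPolynomial (Fin n) F) =
        if (i : ℕ) < j then varSeq F n i else 0 := by
      simp [varSeq]
    simp only [hX]
    rw [Fin.sum_univ_eq_sum_range (fun i => if i < (j : ℕ) then varSeq F n i else 0),
      ← Finset.sum_filter]
    congr 1
    ext i
    simp only [Finset.mem_range, Finset.mem_filter]
    omega
  unfold esym2 seqEsym2
  rw [← Fin.sum_univ_eq_sum_range (fun j => (∑ i ∈ Finset.range j, varSeq F n i) * varSeq F n j),
    Finset.sum_filter, ← Finset.univ_product_univ, Finset.sum_product_right]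
  refine Finset.sum_congr rfl fun j _ => ?_
  rw [hinner, Finset.sum_mul]
  refine Finset.sum_congr rfl fun i _ => ?_
  simp [varSeq]

theorem IsSumOfProducts.exists_coeff {F : Type*} [CommRing F] {n r : ℕ}
    {p : MvPolynomial (Fin n) F}
    (h : IsSumOfProducts (Submodule.span F (Set.range X)) r p) :
    ∃ L R : Fin r → Fin n → F,
      p = ∑ i, (∑ k, C (L i k) * X k) * (∑ k, C (R i k) * X k) := by
  obtain ⟨L, R, hL, hR, rfl⟩ := h
  simp only [Submodule.mem_span_range_iff_exists_fun, smul_eq_C_mul] at hL hR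
  choose L' hL' using hL
  choose R' hR' using hR
  exact ⟨L', R', by simp only [hL', hR']⟩

theorem isSumOfProducts_esym2 {n k : ℕ} (h : n ≤ 8 * k + 1) :
    IsSumOfProducts (Submodule.span (ZMod 2) (Set.range X)) (4 * k) (esym2 (ZMod 2) n) := by
  rw [esym2_eq_seqEsym2, ← seqEsym2_eq_of_le (fun i => varSeq_eq_zero (ZMod 2)) h]
  exact isSumOfProducts_seqEsym2 (varSeq_mem_span (ZMod 2) n) k

theorem isSumOfProducts_esym2_eight_mul_add_two (k : ℕ) :
    IsSumOfProducts (Submodule.span (ZMod 2) (Set.range X)) (4 * k + 1)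
      (esym2 (ZMod 2) (8 * k + 2)) := by
  rw [esym2_eq_seqEsym2, seqEsym2_succ]
  exact (isSumOfProducts_seqEsym2 (varSeq_mem_span _ _) k).add_mul
    (Submodule.sum_mem _ fun i _ => varSeq_mem_span _ _ i) (varSeq_mem_span _ _ _)

/-- For each residue `c ∈ {0, 2, 3}`, there are infinitely many `n ≡ c (mod 4)` such that
`S_n^2` over GF(2) is a sum of `⌈n/2⌉` products of pairs of homogeneous linear forms;
moreover there are infinitely many `n ≡ 1 (mod 4)` such that `S_n^2` over GF(2) is a sum
of `⌊n/2⌋` products of pairs of homogeneous linear forms. -/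
theorem stmt_4 :
    (∀ c ∈ ({0, 2, 3} : Set ℕ), ∀ N : ℕ, ∃ n : ℕ, N ≤ n ∧ n % 4 = c ∧
      ∃ L R : Fin ((n + 1) / 2) → Fin n → ZMod 2,
        esym2 (ZMod 2) n =
          ∑ i : Fin ((n + 1) / 2),
            (∑ k : Fin n, C (L i k) * X k) * (∑ k : Fin n, C (R i k) * X k)) ∧
    (∀ N : ℕ, ∃ n : ℕ, N ≤ n ∧ n % 4 = 1 ∧
      ∃ L R : Fin (n / 2) → Fin n → ZMod 2,
        esym2 (ZMod 2) n =
          ∑ i : Fin (n / 2),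
            (∑ k : Fin n, C (L i k) * X k) * (∑ k : Fin n, C (R i k) * X k)) := by
  refine ⟨fun c hc N => ?_, fun N => ⟨8 * N + 1, by omega, by omega, ?_⟩⟩
  · rcases hc with rfl | rfl | rfl
    · refine ⟨8 * N, by omega, by omega, ?_⟩
      rw [show (8 * N + 1) / 2 = 4 * N by omega]
      exact (isSumOfProducts_esym2 (by omega)).exists_coeff
    · refine ⟨8 * N + 2, by omega, by omega, ?_⟩
      rw [show (8 * N + 2 + 1) / 2 = 4 * N + 1 by omega]
      exact (isSumOfProducts_esym2_eight_mul_add_two N).exists_coeff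
    · refine ⟨8 * N + 7, by omega, by omega, ?_⟩
      rw [show (8 * N + 7 + 1) / 2 = 4 * (N + 1) by omega]
      exact (isSumOfProducts_esym2 (by omega)).exists_coeff
  · rw [show (8 * N + 1) / 2 = 4 * N by omega]
    exact (isSumOfProducts_esym2 le_rfl).exists_coeff
end

section
/- There are infinitely many n with n ≡ 0 (mod 4) such that the complete graph K_n admits an odd cover by n/2 complete bipartite subgraphs, and there are infinitely many n with n ≡ 2 (mod 4) such that K_n admits an odd cover by n/2 complete bipartite subgraphs. -/
/-- `A, B : Fin r → Finset (Fin n)` describe an odd cover of the complete graph `K_n` by `r`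
complete bipartite subgraphs: the colour classes `A i` and `B i` are disjoint, and every
edge `{u, v}` (`u ≠ v`) is covered an odd number of times. -/
def IsOddCover (n r : ℕ) (A B : Fin r → Finset (Fin n)) : Prop :=
  (∀ i, Disjoint (A i) (B i)) ∧
  ∀ u v : Fin n, u ≠ v →
    Odd (Finset.univ.filter
      (fun i : Fin r => (u ∈ A i ∧ v ∈ B i) ∨ (v ∈ A i ∧ u ∈ B i))).card

/-- Two distinct nonzero vectors over `ZMod 3` can be mapped to `1` and `-1` by a functional. -/
theorem exists_dotProduct_eq_one_neg_one {d : ℕ} {u w : Fin d → ZMod 3} (hu : u ≠ 0)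
    (hw : w ≠ 0) (huw : u ≠ w) : ∃ v : Fin d → ZMod 3, u ⬝ᵥ v = 1 ∧ w ⬝ᵥ v = -1 := by
  have h3 : (3 : ZMod 3) = 0 := rfl
  have hmem : u ∉ Submodule.span (ZMod 3) {u + w} := by
    rw [Submodule.mem_span_singleton]
    rintro ⟨c, hc⟩
    have hc3 : ∀ c : ZMod 3, c = 0 ∨ c = 1 ∨ c = -1 := by decide
    rcases hc3 c with rfl | rfl | rfl
    · exact hu (by simpa using hc.symm)
    · exact hw (by simpa using hc)
    · refine huw (funext fun i => ?_)
      have hi := congrFun hc i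
      simp only [Pi.smul_apply, Pi.add_apply, smul_eq_mul] at hi
      linear_combination u i * h3 + hi
  obtain ⟨f, hf, hker⟩ := Submodule.exists_le_ker_of_notMem hmem
  obtain ⟨x, rfl⟩ := (dotProductEquiv (ZMod 3) (Fin d)).surjective f
  have hs : x ⬝ᵥ (u + w) = 0 := hker (Submodule.mem_span_singleton_self _)
  have hx : x ⬝ᵥ u ≠ 0 := hf
  refine ⟨(x ⬝ᵥ u)⁻¹ • x, ?_, ?_⟩
  · rw [dotProduct_smul, dotProduct_comm u x, smul_eq_mul, inv_mul_cancel₀ hx]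
  · rw [dotProduct_add] at hs
    rw [dotProduct_smul, dotProduct_comm w x, smul_eq_mul, eq_neg_of_add_eq_zero_right hs,
      mul_neg, inv_mul_cancel₀ hx]

/-- A nonempty fibre of a pair of functionals over `ZMod 3` has a power of three, hence an odd
number, of elements. -/
theorem odd_card_filter_dotProduct {d : ℕ} {u w : Fin d → ZMod 3} (hu : u ≠ 0)
    (hw : w ≠ 0) (huw : u ≠ w) :
    Odd (Finset.univ.filter
      (fun v : Fin d → ZMod 3 => u ⬝ᵥ v = 1 ∧ w ⬝ᵥ v = -1)).card := by
  obtain ⟨x, hxu, hxw⟩ := exists_dotProduct_eq_one_neg_one hu hw huw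
  let K : AddSubgroup (Fin d → ZMod 3) :=
    { carrier := {v | u ⬝ᵥ v = 0 ∧ w ⬝ᵥ v = 0}
      zero_mem' := by simp
      add_mem' := by
        rintro a b ⟨ha, ha'⟩ ⟨hb, hb'⟩
        simp [dotProduct_add, *]
      neg_mem' := by
        rintro a ⟨ha, ha'⟩
        simp [dotProduct_neg, *] }
  have hK : Odd (Nat.card K) := by
    refine Odd.of_dvd_nat ?_ K.card_addSubgroup_dvd_card
    rw [Nat.card_eq_fintype_card, Fintype.card_pi_const, ZMod.card]
    exact Odd.pow (by decide)
  convert hK using 1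
  rw [← Fintype.card_subtype, ← Nat.card_eq_fintype_card]
  refine Nat.card_congr ((Equiv.subRight x).subtypeEquiv fun v => ?_)
  change _ ↔ u ⬝ᵥ (v - x) = 0 ∧ w ⬝ᵥ (v - x) = 0
  rw [dotProduct_sub, dotProduct_sub, hxu, hxw, sub_eq_zero, sub_eq_zero]

theorem eq_zero_of_eq_neg_zmod_three {d : ℕ} {v : Fin d → ZMod 3} (h : v = -v) : v = 0 := by
  have key : ∀ a : ZMod 3, a = -a → a = 0 := by decide
  exact funext fun i => key _ (congrFun h i)

/-- The canonical representatives of the nonzero vectors over `ZMod 3` up to sign: of `v` and `-v`,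
the one with the smaller index in a fixed enumeration. -/
abbrev SignRep (d : ℕ) : Type :=
  {v : Fin d → ZMod 3 // Fintype.equivFin _ v < Fintype.equivFin _ (-v)}

theorem card_nonzero_zmod_three (d : ℕ) :
    Fintype.card {v : Fin d → ZMod 3 // v ≠ 0} = 3 ^ d - 1 := by
  rw [Fintype.card_subtype_compl, Fintype.card_pi_const, ZMod.card, Fintype.card_subtype_eq]

theorem card_signRep (d : ℕ) : Fintype.card (SignRep d) = (3 ^ d - 1) / 2 := by
  have hneg : Fintype.card (SignRep d) = Fintype.card {v : Fin d → ZMod 3 //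
      Fintype.equivFin _ (-v) < Fintype.equivFin _ v} :=
    Fintype.card_congr ((Equiv.neg _).subtypeEquiv fun v => by simp)
  have hsum : Fintype.card {v : Fin d → ZMod 3 // v ≠ 0} =
      Fintype.card (SignRep d) + Fintype.card {v : Fin d → ZMod 3 //
        Fintype.equivFin _ (-v) < Fintype.equivFin _ v} := by
    rw [← Fintype.card_subtype_or_disjoint]
    · refine Fintype.card_congr (Equiv.subtypeEquivRight fun v => ?_)
      rw [← ne_iff_lt_or_gt, (Fintype.equivFin _).injective.ne_iff]
      refine not_congr ⟨fun h => by simp [h], eq_zero_of_eq_neg_zmod_three⟩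
    · rw [Pi.disjoint_iff]
      intro v
      rw [Prop.disjoint_iff]
      exact fun h => lt_asymm h.1 h.2
  rw [card_nonzero_zmod_three, ← hneg] at hsum
  omega

theorem odd_card_filter_signRep {d : ℕ} {u w : Fin d → ZMod 3} (hu : u ≠ 0)
    (hw : w ≠ 0) (huw : u ≠ w) :
    Odd (Finset.univ.filter (fun v : SignRep d =>
      (u ⬝ᵥ v.1 = 1 ∧ w ⬝ᵥ v.1 = -1) ∨ (w ⬝ᵥ v.1 = 1 ∧ u ⬝ᵥ v.1 = -1))).card := by
  convert odd_card_filter_dotProduct hu hw huw using 1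
  have hne : (-1 : ZMod 3) ≠ 1 := by decide
  refine Finset.card_bij (fun v _ => if u ⬝ᵥ v.1 = 1 then v.1 else -v.1) ?_ ?_ ?_
  · intro v hv
    rw [Finset.mem_filter_univ] at hv ⊢
    rcases hv with ⟨h1, h2⟩ | ⟨h1, h2⟩
    · simp [h1, h2]
    · simp [h1, h2, hne]
  · intro v _ v' _ h
    have hlt := v.2
    have hlt' := v'.2
    split_ifs at h
    · exact Subtype.ext h
    · rw [h, neg_neg] at hlt
      exact absurd hlt' (lt_asymm hlt)
    · rw [← h, neg_neg] at hlt'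
      exact absurd hlt' (lt_asymm hlt)
    · exact Subtype.ext (neg_injective h)
  · intro x hx
    rw [Finset.mem_filter_univ] at hx
    obtain ⟨hxu, hxw⟩ := hx
    have hxneg : x ≠ -x := by
      intro h
      rw [eq_zero_of_eq_neg_zmod_three h, dotProduct_zero] at hxu
      exact absurd hxu (by decide)
    rcases lt_or_gt_of_ne ((Fintype.equivFin _).injective.ne hxneg) with h | h
    · exact ⟨⟨x, h⟩, by simp [hxu, hxw], by simp [hxu]⟩
    · exact ⟨⟨-x, by simpa using h⟩, by simp [hxu, hxw], by simp [hxu, hne]⟩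

/-- Indexing the vertices by nonzero vectors over `ZMod 3` and the bipartite graphs by nonzero
vectors up to sign, the classes `u ⬝ᵥ v = 1` and `u ⬝ᵥ v = -1` form an odd cover. -/
theorem exists_isOddCover_three_pow_sub_one (d : ℕ) :
    ∃ A B : Fin ((3 ^ d - 1) / 2) → Finset (Fin (3 ^ d - 1)),
      IsOddCover (3 ^ d - 1) ((3 ^ d - 1) / 2) A B := by
  let e : Fin (3 ^ d - 1) ≃ {v : Fin d → ZMod 3 // v ≠ 0} :=
    (Fintype.equivFinOfCardEq (card_nonzero_zmod_three d)).symm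
  let g : Fin ((3 ^ d - 1) / 2) ≃ SignRep d :=
    (Fintype.equivFinOfCardEq (card_signRep d)).symm
  refine ⟨fun i => Finset.univ.filter fun u => (e u).1 ⬝ᵥ (g i).1 = 1,
    fun i => Finset.univ.filter fun u => (e u).1 ⬝ᵥ (g i).1 = -1, fun i => ?_, fun u w huw => ?_⟩
  · refine Finset.disjoint_filter.2 fun u _ h => ?_
    rw [h]
    decide
  · convert odd_card_filter_signRep (e u).2 (e w).2
      (fun h => huw (e.injective (Subtype.ext h))) using 1
    rw [← Fintype.card_subtype, ← Fintype.card_subtype]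
    exact Fintype.card_congr (g.subtypeEquiv fun i => by simp)

/-- There are infinitely many `n ≡ 0 (mod 4)` and infinitely many `n ≡ 2 (mod 4)` such that
`K_n` admits an odd cover by `n/2` complete bipartite subgraphs. -/
theorem stmt_5 :
    (∀ N : ℕ, ∃ n : ℕ, N ≤ n ∧ n % 4 = 0 ∧
      ∃ A B : Fin (n / 2) → Finset (Fin n), IsOddCover n (n / 2) A B) ∧
    (∀ N : ℕ, ∃ n : ℕ, N ≤ n ∧ n % 4 = 2 ∧
      ∃ A B : Fin (n / 2) → Finset (Fin n), IsOddCover n (n / 2) A B) := by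
  have hmod (N : ℕ) : 3 ^ (2 * N) % 4 = 1 := by
    rw [pow_mul, Nat.pow_mod]
    norm_num
  have hlt (N : ℕ) : 2 * N < 3 ^ (2 * N) := Nat.lt_pow_self (by norm_num)
  refine ⟨fun N => ⟨3 ^ (2 * N) - 1, ?_, ?_, exists_isOddCover_three_pow_sub_one _⟩,
    fun N => ⟨3 ^ (2 * N + 1) - 1, ?_, ?_, exists_isOddCover_three_pow_sub_one _⟩⟩
  all_goals
    have h1 := hmod N
    have h2 := hlt N
    try rw [pow_succ]
    omega
end

section
/- There are infinitely many n with n ≡ 1 (mod 4) such that the complete graph K_n admits an odd cover by ⌈n/2⌉ complete bipartite subgraphs, and there are infinitely many n with n ≡ 3 (mod 4) such that K_n admits an odd cover by ⌈n/2⌉ complete bipartite subgraphs. -/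
/-- For every `m`, the graph `K_{2m+1}` has an odd cover by `m + 1` complete bipartite subgraphs.
The `k`-th one, `k < m`, has classes `{k, m + k}` and `{u | u < k ∨ m + k < u}`; the last one has
classes `{m, …, 2m - 1}` and `{0, …, m - 1}`. -/
theorem exists_isOddCover (n r m : ℕ) (hn : n = 2 * m + 1) (hr : r = m + 1) :
    ∃ A B : Fin r → Finset (Fin n), IsOddCover n r A B := by
  subst hn hr
  let A : Fin (m + 1) → Finset (Fin (2 * m + 1)) := fun k => Finset.univ.filter fun u =>
    if k.val < m then u.val = k.val ∨ u.val = m + k.val else m ≤ u.val ∧ u.val < 2 * m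
  let B : Fin (m + 1) → Finset (Fin (2 * m + 1)) := fun k => Finset.univ.filter fun u =>
    if k.val < m then u.val < k.val ∨ m + k.val < u.val else u.val < m
  have hA (k u) : u ∈ A k ↔
      if k.val < m then u.val = k.val ∨ u.val = m + k.val else m ≤ u.val ∧ u.val < 2 * m := by
    simp [A]
  have hB (k u) : u ∈ B k ↔
      if k.val < m then u.val < k.val ∨ m + k.val < u.val else u.val < m := by
    simp [B]
  refine ⟨A, B, fun k => ?_, fun u v huv => ?_⟩
  · rw [Finset.disjoint_left]
    intro u hu hu'
    rw [hA] at hu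
    rw [hB] at hu'
    split_ifs at hu hu' <;> omega
  wlog h : u < v generalizing u v
  · have hvu := this v u huv.symm (lt_of_le_of_ne (not_lt.mp h) huv.symm)
    simpa only [or_comm] using hvu
  have huv' : u.val < v.val := h
  have hv := v.isLt
  have odd_of_singleton (c : ℕ) (hc : c < m + 1)
      (h : ∀ k : Fin (m + 1), ((u ∈ A k ∧ v ∈ B k) ∨ (v ∈ A k ∧ u ∈ B k)) ↔ k.val = c) :
      Odd (Finset.univ.filter
        (fun k => (u ∈ A k ∧ v ∈ B k) ∨ (v ∈ A k ∧ u ∈ B k))).card := by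
    have hs : Finset.univ.filter (fun k => (u ∈ A k ∧ v ∈ B k) ∨ (v ∈ A k ∧ u ∈ B k)) =
        {(⟨c, hc⟩ : Fin (m + 1))} := by
      ext k
      simp [h, Fin.ext_iff]
    rw [hs, Finset.card_singleton]
    exact odd_one
  simp only [hA, hB] at odd_of_singleton ⊢
  by_cases hvm : v.val < m
  · exact odd_of_singleton v (by omega) fun k => by split_ifs <;> omega
  by_cases hum : m ≤ u.val
  · exact odd_of_singleton (u.val - m) (by omega) fun k => by split_ifs <;> omega
  by_cases hv2 : v.val = 2 * m
  · exact odd_of_singleton u (by omega) fun k => by split_ifs <;> omega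
  by_cases huw : u.val < v.val - m
  · have hs : Finset.univ.filter (fun k : Fin (m + 1) =>
          ((if k.val < m then u.val = k.val ∨ u.val = m + k.val else m ≤ u.val ∧ u.val < 2 * m) ∧
            (if k.val < m then v.val < k.val ∨ m + k.val < v.val else v.val < m)) ∨
          ((if k.val < m then v.val = k.val ∨ v.val = m + k.val else m ≤ v.val ∧ v.val < 2 * m) ∧
            (if k.val < m then u.val < k.val ∨ m + k.val < u.val else u.val < m))) =
        {(⟨u.val, by omega⟩ : Fin (m + 1)), ⟨v.val - m, by omega⟩, ⟨m, by omega⟩} := by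
      ext k
      simp only [Finset.mem_filter, Finset.mem_univ, true_and, Finset.mem_insert,
        Finset.mem_singleton, Fin.ext_iff]
      split_ifs <;> omega
    rw [hs, Finset.card_eq_three.mpr ⟨_, _, _, ?_, ?_, ?_, rfl⟩]
    · decide
    all_goals simp only [ne_eq, Fin.ext_iff]; omega
  · exact odd_of_singleton m (by omega) fun k => by split_ifs <;> omega

/-- There are infinitely many `n ≡ 1 (mod 4)` and infinitely many `n ≡ 3 (mod 4)` such that
`K_n` admits an odd cover by `⌈n/2⌉` complete bipartite subgraphs. -/
theorem stmt_6 :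
    (∀ N : ℕ, ∃ n : ℕ, N ≤ n ∧ n % 4 = 1 ∧
      ∃ A B : Fin ((n + 1) / 2) → Finset (Fin n), IsOddCover n ((n + 1) / 2) A B) ∧
    (∀ N : ℕ, ∃ n : ℕ, N ≤ n ∧ n % 4 = 3 ∧
      ∃ A B : Fin ((n + 1) / 2) → Finset (Fin n), IsOddCover n ((n + 1) / 2) A B) := by
  refine ⟨fun N => ⟨4 * N + 1, by omega, by omega, ?_⟩,
    fun N => ⟨4 * N + 3, by omega, by omega, ?_⟩⟩
  · exact exists_isOddCover _ _ (2 * N) (by omega) (by omega)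
  · exact exists_isOddCover _ _ (2 * N + 1) (by omega) (by omega)
end

section
/- Let p ≥ 3 be an odd integer. There are infinitely many even n such that the complete graph K_n admits a 1 mod p cover by n/2 complete bipartite subgraphs, and there are infinitely many odd n such that K_n admits a 1 mod p cover by ⌈n/2⌉ complete bipartite subgraphs. -/
/-- `A, B : Fin r → Finset (Fin n)` describe a `1 mod p` cover of the complete graph `K_n`
by `r` complete bipartite subgraphs: the colour classes `A i` and `B i` are disjoint, and
every edge `{u, v}` (`u ≠ v`) is covered a number of times congruent to `1` modulo `p`. -/
def IsOneModPCover (p n r : ℕ) (A B : Fin r → Finset (Fin n)) : Prop :=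
  (∀ i, Disjoint (A i) (B i)) ∧
  ∀ u v : Fin n, u ≠ v →
    (Finset.univ.filter
      (fun i : Fin r => (u ∈ A i ∧ v ∈ B i) ∨ (v ∈ A i ∧ u ∈ B i))).card % p = 1

open Finset
open scoped LinearAlgebra.Projectivization

/-- Restricting a cover to the first `m` vertices. -/
theorem IsOneModPCover.restrict {p m n r : ℕ} (hmn : m ≤ n) {A B : Fin r → Finset (Fin n)}
    (h : IsOneModPCover p n r A B) :
    ∃ A' B' : Fin r → Finset (Fin m), IsOneModPCover p m r A' B' := by
  refine ⟨fun i => {v | Fin.castLE hmn v ∈ A i}, fun i => {v | Fin.castLE hmn v ∈ B i}, ?_, ?_⟩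
  · intro i
    rw [Finset.disjoint_filter]
    exact fun v _ hA hB => Finset.disjoint_left.mp (h.1 i) hA hB
  · intro u v huv
    simpa using h.2 (Fin.castLE hmn u) (Fin.castLE hmn v) (by simpa using huv)

/-- The rows of `W` together with their negatives, read as the incidence vectors of `2 r` vertices
with `r` complete bipartite graphs, form a `1 mod p` cover. -/
theorem exists_isOneModPCover_of_signMatrix {p r : ℕ} {ι : Type*} [Fintype ι] [DecidableEq ι]
    (hr : Fintype.card ι = r) (W : ι → ι → ℤ)
    (hself : ∀ i, #{l | W i l * W i l = 1} % p = 1)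
    (hpair : ∀ i j, i ≠ j → ∀ c : ℤˣ, #{l | W i l * W j l = c} % p = 1) :
    ∃ A B : Fin r → Finset (Fin (2 * r)), IsOneModPCover p (2 * r) r A B := by
  let e : Fin (2 * r) ≃ ι × ℤˣ := (Fintype.equivFinOfCardEq (by simp [hr, mul_comm])).symm
  let f : Fin r ≃ ι := (Fintype.equivFinOfCardEq hr).symm
  let x : Fin (2 * r) → ι → ℤ := fun v l => (e v).2 * W (e v).1 l
  refine ⟨fun i => {v | x v (f i) = 1}, fun i => {v | x v (f i) = -1}, ?_, ?_⟩
  · intro i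
    rw [Finset.disjoint_filter]
    intro v _ h1 h2
    omega
  · intro u v huv
    have hcount : #{i : Fin r | (x u (f i) = 1 ∧ x v (f i) = -1) ∨
        (x v (f i) = 1 ∧ x u (f i) = -1)} = #{l : ι | x u l * x v l = -1} := by
      refine Finset.card_equiv f fun i => ?_
      simp only [mem_filter, mem_univ, true_and, Int.mul_eq_neg_one_iff_eq_one_or_neg_one]
      tauto
    simp only [mem_filter, mem_univ, true_and]
    rw [hcount]
    have hprod : ∀ l, x u l * x v l = -1 ↔
        W (e u).1 l * W (e v).1 l = ((-((e u).2 * (e v).2) : ℤˣ) : ℤ) := by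
      intro l
      rcases Int.units_eq_one_or (e u).2 with h | h <;>
        rcases Int.units_eq_one_or (e v).2 with h' | h' <;> simp [x, h, h']
    simp only [hprod]
    by_cases hij : (e u).1 = (e v).1
    · have hne : (e u).2 ≠ (e v).2 := fun h => huv (e.injective (Prod.ext hij h))
      have hs : -((e u).2 * (e v).2) = 1 := by
        rcases Int.units_eq_one_or (e u).2 with h | h <;>
          rcases Int.units_eq_one_or (e v).2 with h' | h' <;> simp_all
      rw [hs, hij]
      exact hself _
    · exact hpair _ _ hij _

/-- A scaling invariant subset of `V` avoiding `0` consists of whole punctured lines. -/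
theorem Projectivization.card_filter_rep_mul {k V : Type*} [Field k] [Fintype k] [DecidableEq k]
    [AddCommGroup V] [Module k V] [Fintype V] [Fintype (ℙ k V)] (Q : V → Prop) [DecidablePred Q]
    (h0 : ¬ Q 0) (hQ : ∀ (a : kˣ) (v : V), Q (a • v) ↔ Q v) :
    #{P : ℙ k V | Q P.rep} * (Fintype.card k - 1) = #{v : V | Q v} := by
  classical
  rw [← Fintype.card_units, ← Finset.card_univ, ← Finset.card_product]
  refine Finset.card_bij (fun x _ => x.2 • x.1.rep) ?_ ?_ ?_
  · rintro ⟨P, a⟩ h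
    simpa [hQ] using h
  · rintro ⟨P, a⟩ _ ⟨P', a'⟩ _ h
    simp only at h
    have hP : P = P' := by
      rw [← P.mk_rep, ← P'.mk_rep, Projectivization.mk_eq_mk_iff]
      exact ⟨a⁻¹ * a', by rw [mul_smul, ← h, inv_smul_smul]⟩
    subst hP
    have ha : (a : k) = a' := smul_left_injective k P.rep_nonzero h
    rw [Units.ext ha]
  · intro v hv
    have hv0 : v ≠ 0 := by
      rintro rfl
      simp [h0] at hv
    obtain ⟨a, ha⟩ := Projectivization.exists_smul_eq_mk_rep k v hv0
    refine ⟨(Projectivization.mk k v hv0, a⁻¹), ?_, ?_⟩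
    · simpa [← ha, hQ] using hv
    · simp [← ha]

/-- All fibres of the linear map given by a matrix with independent rows have the same size. -/
theorem Matrix.card_filter_mulVec_mul {k : Type*} [Field k] [Fintype k] [DecidableEq k] {m n : ℕ}
    (M : Matrix (Fin m) (Fin n) k) (hM : LinearIndependent k M.row) (Q : (Fin m → k) → Prop)
    [DecidablePred Q] :
    #{x : Fin n → k | Q (M.mulVec x)} * Fintype.card k ^ m =
      #{y : Fin m → k | Q y} * Fintype.card k ^ n := by
  have hsurj : Function.Surjective M.mulVecLin := by
    rw [← LinearMap.range_eq_top]
    apply Submodule.eq_top_of_finrank_eq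
    rw [← Matrix.rank, hM.rank_matrix]
    simp
  have hfib : ∀ y, #{x | M.mulVecLin x = y} = #{x | M.mulVecLin x = 0} := fun y =>
    AddMonoidHom.card_fiber_eq_of_mem_range M.mulVecLin (hsurj y) (hsurj 0)
  have hcount : ∀ S : Finset (Fin m → k),
      #{x | M.mulVec x ∈ S} = #S * #{x | M.mulVecLin x = 0} := by
    intro S
    rw [Finset.card_eq_sum_card_fiberwise (f := M.mulVecLin) (t := S)
      (by intro x hx; simpa using hx), ← smul_eq_mul, ← Finset.sum_const]
    refine Finset.sum_congr rfl fun y hy => ?_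
    rw [← hfib y, Finset.filter_filter]
    refine congrArg card (Finset.filter_congr fun x _ => and_iff_right_of_imp ?_)
    rintro rfl
    exact hy
  have hall := hcount univ
  have hQ := hcount {y | Q y}
  simp only [mem_univ, Finset.filter_true, Finset.card_univ, Fintype.card_pi, Finset.prod_const,
    Fintype.card_fin, mem_filter, true_and] at hall hQ
  rw [hQ, hall]
  ring

/-- Each of the values `1` and `-1` is attained by the quadratic character equally often. -/
theorem two_mul_card_quadraticChar_eq {F : Type*} [Field F] [Fintype F] [DecidableEq F]
    (hF : ringChar F ≠ 2) (c : ℤˣ) :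
    2 * #{a : F | quadraticChar F a = c} = Fintype.card F - 1 := by
  have hdiff : (#{a : F | quadraticChar F a = 1} : ℤ) - #{a : F | quadraticChar F a = -1} = 0 := by
    rw [← quadraticChar_sum_zero hF, Finset.card_filter, Finset.card_filter]
    push_cast
    rw [← Finset.sum_sub_distrib]
    refine Finset.sum_congr rfl fun a _ => ?_
    rcases quadraticChar_isQuadratic F a with h | h | h <;> simp [h]
  have hsum : #{a : F | quadraticChar F a = 1} + #{a : F | quadraticChar F a = -1} =
      Fintype.card F - 1 := by
    rw [← Finset.card_union_of_disjoint, ← Finset.card_univ, ← Finset.card_erase_of_mem (mem_univ (0 : F))]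
    · congr 1
      ext a
      by_cases ha : a = 0
      · simp [ha]
      · simpa [ha] using quadraticChar_dichotomy ha
    · rw [Finset.disjoint_filter]
      intro a _ h1 h2
      omega
  rcases Int.units_eq_one_or c with rfl | rfl <;> push_cast <;> omega

theorem two_mul_card_quadraticChar_mul_eq {F : Type*} [Field F] [Fintype F] [DecidableEq F]
    (hF : ringChar F ≠ 2) (c : ℤˣ) :
    2 * #{y : Fin 2 → F | quadraticChar F (y 0) * quadraticChar F (y 1) = c} =
      (Fintype.card F - 1) ^ 2 := by
  let N : ℤˣ → Finset F := fun d => {a : F | quadraticChar F a = d}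
  have hcard : #{y : Fin 2 → F | quadraticChar F (y 0) * quadraticChar F (y 1) = c} =
      #(N 1 ×ˢ N c ∪ N (-1) ×ˢ N (-c)) := by
    refine Finset.card_equiv (finTwoArrowEquiv F) fun y => ?_
    rcases Int.units_eq_one_or c with rfl | rfl <;>
    rcases quadraticChar_isQuadratic F (y 0) with h | h | h <;>
      rcases quadraticChar_isQuadratic F (y 1) with h' | h' | h' <;> simp [N, h, h', -quadraticChar_apply]
  rw [hcard, Finset.card_union_of_disjoint, Finset.card_product, Finset.card_product]
  · have h : ∀ d, 2 * #(N d) = Fintype.card F - 1 := two_mul_card_quadraticChar_eq hF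
    have h1 := h 1
    have h2 := h (-1)
    have h3 := h c
    have h4 := h (-c)
    have e2 : #(N (-1)) = #(N 1) := by omega
    have e3 : #(N c) = #(N 1) := by omega
    have e4 : #(N (-c)) = #(N 1) := by omega
    rw [← h1, e2, e3, e4]
    ring
  · rw [Finset.disjoint_left]
    rintro ⟨a, b⟩ h1 h2
    simp only [N, mem_product, mem_filter, mem_univ, true_and, Units.val_one, Units.val_neg]
      at h1 h2
    omega

section ProjectivePlane

variable {F : Type*} [Field F] [Fintype F] [Fintype (ℙ F (Fin 3 → F))]

theorem card_projectivePlane :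
    Fintype.card (ℙ F (Fin 3 → F)) = Fintype.card F ^ 2 + Fintype.card F + 1 := by
  rw [Fintype.card_eq_nat_card, Projectivization.card_of_finrank F (Fin 3 → F) (n := 3) (by simp)]
  simp [Finset.sum_range_succ]
  ring

variable [DecidableEq F]

/-- A line of the projective plane misses `q ^ 2` points. -/
theorem card_quadraticChar_dotProduct_self (P : ℙ F (Fin 3 → F)) :
    #{L : ℙ F (Fin 3 → F) | quadraticChar F (P.rep ⬝ᵥ L.rep) * quadraticChar F (P.rep ⬝ᵥ L.rep) = 1}
      = Fintype.card F ^ 2 := by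
  have hχ : ∀ a : F, quadraticChar F a * quadraticChar F a = 1 ↔ a ≠ 0 := by
    intro a
    by_cases ha : a = 0
    · simp [ha]
    · simpa [ha, ← sq] using quadraticChar_sq_one ha
  simp only [hχ]
  have hrep := Projectivization.card_filter_rep_mul (k := F) (fun v => P.rep ⬝ᵥ v ≠ 0) (by simp)
    (by intro a v; simp [Units.smul_def])
  have hfib := Matrix.card_filter_mulVec_mul (Matrix.of ![P.rep])
    (by
      rw [linearIndependent_unique_iff]
      exact P.rep_nonzero)
    (fun y => y 0 ≠ 0)
  have hy : #{y : Fin 1 → F | y 0 ≠ 0} = Fintype.card F - 1 := by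
    rw [← Finset.card_univ, ← Finset.card_erase_of_mem (mem_univ (0 : F))]
    exact Finset.card_equiv (Equiv.funUnique (Fin 1) F) (by simp)
  have hq : 1 < Fintype.card F := Fintype.one_lt_card
  rw [hy] at hfib
  change #{x | P.rep ⬝ᵥ x ≠ 0} * _ = _ at hfib
  rw [← hrep] at hfib
  have hpos : 0 < (Fintype.card F - 1) * Fintype.card F := by
    apply Nat.mul_pos <;> omega
  refine Nat.eq_of_mul_eq_mul_right hpos ?_
  linear_combination hfib

/-- The quadratic characters of two distinct linear forms on the projective plane are orthogonal,
with each product value attained `q (q - 1) / 2` times. -/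
theorem two_mul_card_quadraticChar_dotProduct (hF : ringChar F ≠ 2) {P Q : ℙ F (Fin 3 → F)}
    (hPQ : P ≠ Q) (c : ℤˣ) :
    2 * #{L : ℙ F (Fin 3 → F) |
        quadraticChar F (P.rep ⬝ᵥ L.rep) * quadraticChar F (Q.rep ⬝ᵥ L.rep) = c}
      = Fintype.card F * (Fintype.card F - 1) := by
  have hrep := Projectivization.card_filter_rep_mul (k := F)
    (fun v => quadraticChar F (P.rep ⬝ᵥ v) * quadraticChar F (Q.rep ⬝ᵥ v) = c)
    (by simpa using (Units.ne_zero c).symm)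
    (by
      intro a v
      have ha := quadraticChar_sq_one a.ne_zero
      simp only [Units.smul_def, dotProduct_smul, smul_eq_mul, map_mul]
      rw [mul_mul_mul_comm, ← sq, ha, one_mul])
  have hfib := Matrix.card_filter_mulVec_mul (Matrix.of ![P.rep, Q.rep])
    (Projectivization.linearIndependent_pair_iff_ne.mpr hPQ)
    (fun y => quadraticChar F (y 0) * quadraticChar F (y 1) = c)
  change #{x | quadraticChar F (P.rep ⬝ᵥ x) * quadraticChar F (Q.rep ⬝ᵥ x) = c} * _ = _ at hfib
  have hq : 1 < Fintype.card F := Fintype.one_lt_card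
  have hy := two_mul_card_quadraticChar_mul_eq hF c
  rw [← hrep] at hfib
  have hpos : 0 < (Fintype.card F - 1) * Fintype.card F ^ 2 := by
    apply Nat.mul_pos
    · omega
    · positivity
  refine Nat.eq_of_mul_eq_mul_right hpos ?_
  linear_combination 2 * hfib + Fintype.card F ^ 3 * hy

end ProjectivePlane

/-- An odd prime `q ≡ -1 [MOD p]` yields a `1 mod p` cover from the projective plane of order `q`. -/
theorem exists_isOneModPCover_of_prime {p q : ℕ} (hp : 3 ≤ p) (hodd : Odd p) (hq : q.Prime)
    (hq2 : q ≠ 2) (hmod : (q : ZMod p) = -1) :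
    ∃ A B : Fin (q ^ 2 + q + 1) → Finset (Fin (2 * (q ^ 2 + q + 1))),
      IsOneModPCover p (2 * (q ^ 2 + q + 1)) (q ^ 2 + q + 1) A B := by
  classical
  have : Fact q.Prime := ⟨hq⟩
  have : Fintype (ℙ (ZMod q) (Fin 3 → ZMod q)) := Fintype.ofFinite _
  have hmod_one : ∀ m : ℕ, (m : ZMod p) = 1 → m % p = 1 := by
    intro m hm
    have h : (m : ZMod p) = (1 : ℕ) := by simpa using hm
    rw [ZMod.natCast_eq_natCast_iff'] at h
    rwa [Nat.mod_eq_of_lt (show 1 < p by omega)] at h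
  have htwo : IsUnit (2 : ZMod p) := by
    have h := (ZMod.isUnit_iff_coprime 2 p).mpr (Nat.coprime_two_left.mpr hodd)
    simpa using h
  refine exists_isOneModPCover_of_signMatrix (ι := ℙ (ZMod q) (Fin 3 → ZMod q))
    (by rw [card_projectivePlane, ZMod.card])
    (fun P L => quadraticChar (ZMod q) (P.rep ⬝ᵥ L.rep)) ?_ ?_
  · intro P
    rw [card_quadraticChar_dotProduct_self, ZMod.card]
    apply hmod_one
    push_cast
    rw [hmod]
    ring
  · intro P Q hPQ c
    apply hmod_one
    have h := two_mul_card_quadraticChar_dotProduct (by rwa [ZMod.ringChar_zmod_n]) hPQ c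
    rw [ZMod.card] at h
    apply htwo.mul_left_cancel
    have h' := congrArg (Nat.cast : ℕ → ZMod p) h
    rw [Nat.cast_mul, Nat.cast_mul, Nat.cast_sub hq.one_le, hmod] at h'
    push_cast at h'
    rw [h']
    ring

/-- For any odd `p ≥ 3`, there are infinitely many even `n` such that `K_n` admits a
`1 mod p` cover by `n/2` complete bipartite subgraphs, and infinitely many odd `n` such
that `K_n` admits a `1 mod p` cover by `⌈n/2⌉` complete bipartite subgraphs. -/
theorem stmt_7 (p : ℕ) (hp : 3 ≤ p) (hodd : Odd p) :
    (∀ N : ℕ, ∃ n : ℕ, N ≤ n ∧ Even n ∧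
      ∃ A B : Fin (n / 2) → Finset (Fin n), IsOneModPCover p n (n / 2) A B) ∧
    (∀ N : ℕ, ∃ n : ℕ, N ≤ n ∧ Odd n ∧
      ∃ A B : Fin ((n + 1) / 2) → Finset (Fin n), IsOneModPCover p n ((n + 1) / 2) A B) := by
  have : NeZero p := ⟨by omega⟩
  have key : ∀ N : ℕ, ∃ r, N < r ∧
      ∃ A B : Fin r → Finset (Fin (2 * r)), IsOneModPCover p (2 * r) r A B := by
    intro N
    obtain ⟨q, hqN, hq, hmod⟩ :=
      Nat.forall_exists_prime_gt_and_eq_mod (q := p) (a := -1) isUnit_one.neg (N + 2)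
    exact ⟨q ^ 2 + q + 1, by nlinarith,
      exists_isOneModPCover_of_prime hp hodd hq (by omega) hmod⟩
  constructor
  · intro N
    obtain ⟨r, hr, hcover⟩ := key N
    refine ⟨2 * r, by omega, even_two_mul r, ?_⟩
    rwa [show 2 * r / 2 = r by omega]
  · intro N
    obtain ⟨r, hr, A, B, hcover⟩ := key N
    refine ⟨2 * r - 1, by omega, ⟨r - 1, by omega⟩, ?_⟩
    rw [show (2 * r - 1 + 1) / 2 = r by omega]
    exact hcover.restrict (by omega)
end

section
/- If there exists a good n × n matrix, then the complete graph K_{2n} admits an odd cover by n complete bipartite subgraphs. -/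
/-- An `n × n` integer matrix is *good* if its entries lie in `{-1, 0, 1}`, every row has an
odd number of non-zero entries, every pair of distinct rows has a number of columns where
both are non-zero congruent to `2 mod 4`, and distinct rows are orthogonal over ℤ. -/
def IsGoodMatrix {n : ℕ} (M : Matrix (Fin n) (Fin n) ℤ) : Prop :=
  (∀ i j, M i j = -1 ∨ M i j = 0 ∨ M i j = 1) ∧
  (∀ i, Odd (Finset.univ.filter (fun j => M i j ≠ 0)).card) ∧
  (∀ i i', i ≠ i' →
    (Finset.univ.filter (fun j => M i j ≠ 0 ∧ M i' j ≠ 0)).card % 4 = 2) ∧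
  (∀ i i', i ≠ i' → ∑ j, M i j * M i' j = 0)

/-- For sign vectors `x, y`, twice the number of coordinates at which they take opposite non-zero
values is the size of their common support minus their inner product. -/
theorem two_mul_card_opposite_add_sum {ι : Type*} [Fintype ι] (x y : ι → ℤ)
    (hx : ∀ k, x k = -1 ∨ x k = 0 ∨ x k = 1) (hy : ∀ k, y k = -1 ∨ y k = 0 ∨ y k = 1) :
    2 * ((Finset.univ.filter
        (fun k => (x k = 1 ∧ y k = -1) ∨ (y k = 1 ∧ x k = -1))).card : ℤ) + ∑ k, x k * y k =
      ((Finset.univ.filter (fun k => x k ≠ 0 ∧ y k ≠ 0)).card : ℤ) := by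
  simp only [Finset.card_filter, Nat.cast_sum, Finset.mul_sum, ← Finset.sum_add_distrib]
  refine Finset.sum_congr rfl fun k _ => ?_
  rcases hx k with h | h | h <;> rcases hy k with h' | h' | h' <;> simp [h, h']

/-- If a good `n × n` matrix exists, then `K_{2n}` admits an odd cover by `n` complete
bipartite subgraphs. -/
theorem stmt_8 (n : ℕ) (M : Matrix (Fin n) (Fin n) ℤ) (hM : IsGoodMatrix M) :
    ∃ A B : Fin n → Finset (Fin (2 * n)), IsOddCover (2 * n) n A B := by
  obtain ⟨hent, hodd, hsupp, horth⟩ := hM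
  -- The vertices are labelled by the rows of `M` and their negatives.
  let e : Fin (2 * n) ≃ Fin 2 × Fin n := finProdFinEquiv.symm
  let ε : Fin 2 → ℤ := ![1, -1]
  have hε : ∀ a, ε a = 1 ∨ ε a = -1 := by simp [ε, Fin.forall_fin_two]
  let s : Fin (2 * n) → Fin n → ℤ := fun v k => ε (e v).1 * M (e v).2 k
  have hs : ∀ v k, s v k = -1 ∨ s v k = 0 ∨ s v k = 1 := fun v k => by
    rcases hε (e v).1 with h | h <;> rcases hent (e v).2 k with h' | h' | h' <;> simp [s, h, h']
  have hs0 : ∀ v k, s v k ≠ 0 ↔ M (e v).2 k ≠ 0 := fun v k => by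
    rcases hε (e v).1 with h | h <;> simp [s, h]
  refine ⟨fun k => Finset.univ.filter fun v => s v k = 1,
    fun k => Finset.univ.filter fun v => s v k = -1, fun k => ?_, fun u v huv => ?_⟩
  · rw [Finset.disjoint_filter]
    intro v _ h h'
    omega
  · simp only [Finset.mem_filter, Finset.mem_univ, true_and]
    have key := two_mul_card_opposite_add_sum (s u) (s v) (hs u) (hs v)
    simp only [hs0] at key
    rw [Nat.odd_iff]
    by_cases hrow : (e u).2 = (e v).2
    · have hsign : ε (e u).1 * ε (e v).1 = -1 := by
        have hne : (e u).1 ≠ (e v).1 := fun h => huv (e.injective (Prod.ext h hrow))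
        generalize (e u).1 = a at hne
        generalize (e v).1 = b at hne
        fin_cases a <;> fin_cases b <;> simp_all [ε]
      have hsum : ∑ k, s u k * s v k =
          -((Finset.univ.filter fun k => M (e v).2 k ≠ 0).card : ℤ) := by
        rw [Finset.card_filter, Nat.cast_sum, ← Finset.sum_neg_distrib]
        refine Finset.sum_congr rfl fun k _ => ?_
        simp only [s, hrow]
        rw [mul_mul_mul_comm, hsign]
        rcases hent (e v).2 k with h | h | h <;> simp [h]
      have hc := Nat.odd_iff.mp (hodd (e v).2)
      simp only [hrow, and_self] at key
      omega
    · have hsum : ∑ k, s u k * s v k = 0 := by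
        calc ∑ k, s u k * s v k
            = ∑ k, ε (e u).1 * ε (e v).1 * (M (e u).2 k * M (e v).2 k) :=
              Finset.sum_congr rfl fun k _ => mul_mul_mul_comm _ _ _ _
          _ = 0 := by rw [← Finset.mul_sum, horth _ _ hrow, mul_zero]
      have hc := hsupp _ _ hrow
      omega
end

section
/- If q is a prime power with q ≡ 3 (mod 4), then there exists a good matrix of order q² + q + 1. -/
open scoped LinearAlgebra.Projectivization

/-- The nonzero vectors are obtained, each exactly once, by scaling the chosen representatives
of the points of the projective space. -/
theorem Projectivization.bijective_smul_rep (K V : Type*) [Field K] [AddCommGroup V] [Module K V] :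
    Function.Bijective (fun x : ℙ K V × Kˣ =>
      (⟨x.2 • x.1.rep, (smul_ne_zero_iff_ne x.2).2 x.1.rep_nonzero⟩ : {v : V // v ≠ 0})) := by
  constructor
  · rintro ⟨p, a⟩ ⟨p', a'⟩ h
    have h' : a • p.rep = a' • p'.rep := congrArg Subtype.val h
    have hp : p = p' := by
      rw [← p.mk_rep, ← p'.mk_rep, mk_eq_mk_iff]
      exact ⟨a⁻¹ * a', by rw [mul_smul, ← h', inv_smul_smul]⟩
    subst hp
    have ha : (a : K) = a' := smul_left_injective K p.rep_nonzero h'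
    rw [Units.ext ha]
  · rintro ⟨v, hv⟩
    obtain ⟨a, ha⟩ := exists_smul_eq_mk_rep K v hv
    exact ⟨(mk K v hv, a⁻¹), Subtype.ext (by simp [← ha])⟩

/-- A sum over all vectors of a scale-invariant function vanishing at `0` reduces to a sum over
the projective space. -/
theorem Projectivization.sum_eq_card_units_mul_sum_rep {K V : Type*} [Field K] [AddCommGroup V]
    [Module K V] [Fintype K] [Fintype V] [Fintype (ℙ K V)] (f : V → ℤ) (h0 : f 0 = 0)
    (hf : ∀ (a : Kˣ) v, f (a • v) = f v) :
    ∑ v, f v = ((Fintype.card K : ℤ) - 1) * ∑ p : ℙ K V, f p.rep := by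
  classical
  have hV : ∑ v, f v = ∑ v : {v : V // v ≠ 0}, f v := by
    rw [← Finset.sum_subtype (Finset.univ.filter (· ≠ 0)) (by simp) f, Finset.sum_filter_of_ne]
    rintro v - hv rfl
    exact hv h0
  rw [hV, ← (bijective_smul_rep K V).sum_comp (fun v : {v : V // v ≠ 0} => f v),
    Fintype.sum_prod_type]
  simp only [hf, Finset.sum_const, Finset.card_univ, Fintype.card_units, nsmul_eq_mul,
    ← Finset.mul_sum]
  rw [Nat.cast_sub Fintype.card_pos, Nat.cast_one]

/-- A surjective homomorphism of finite groups has fibres of equal size. -/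
theorem AddMonoidHom.card_mul_sum_comp_of_surjective {G H : Type*} [AddCommGroup G]
    [AddCommGroup H] [Fintype G] [Fintype H] (L : G →+ H) (hL : Function.Surjective L)
    (g : H → ℤ) :
    (Fintype.card H : ℤ) * ∑ y, g (L y) = Fintype.card G * ∑ w, g w := by
  classical
  have translate : ∀ w, ∑ y, g (L y) = ∑ y, g (L y + w) := by
    intro w
    obtain ⟨z, rfl⟩ := hL w
    simpa using (Fintype.sum_equiv (Equiv.addRight z) (fun y => g (L (y + z)))
      (fun y => g (L y)) fun _ => rfl).symm
  calc (Fintype.card H : ℤ) * ∑ y, g (L y) = ∑ w, ∑ y, g (L y + w) := by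
        simp [← translate]
    _ = ∑ y, ∑ w, g (L y + w) := Finset.sum_comm
    _ = ∑ _y : G, ∑ w, g w :=
        Finset.sum_congr rfl fun y _ => Fintype.sum_equiv (Equiv.addLeft (L y)) _ _ fun _ => rfl
    _ = _ := by simp

theorem Matrix.mulVec_surjective_of_linearIndependent_row {K m n : Type*} [Field K] [Fintype m]
    [Fintype n] (A : Matrix m n K) (hA : LinearIndependent K A.row) :
    Function.Surjective A.mulVecLin := by
  rw [← LinearMap.range_eq_top]
  apply Submodule.eq_top_of_finrank_eq
  rw [Module.finrank_fintype_fun_eq_card, ← hA.rank_matrix]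
  rfl

/-- Summing a product of functions of `k` independent linear forms over a projective space. -/
theorem Projectivization.sum_prod_dotProduct_rep {F : Type*} [Field F] [Fintype F] {k m : ℕ}
    [Fintype (ℙ F (Fin m → F))] (hk : k ≠ 0) (A : Fin k → Fin m → F)
    (hA : LinearIndependent F A) (h : F → ℤ) (h0 : h 0 = 0)
    (hinv : ∀ (a : Fˣ) (w : Fin k → F), ∏ i, h (a * w i) = ∏ i, h (w i)) :
    (Fintype.card F : ℤ) ^ k * (((Fintype.card F : ℤ) - 1) *
      ∑ p : ℙ F (Fin m → F), ∏ i, h (A i ⬝ᵥ p.rep)) =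
      (Fintype.card F : ℤ) ^ m * (∑ a, h a) ^ k := by
  classical
  have hproj := sum_eq_card_units_mul_sum_rep (K := F) (V := Fin m → F)
    (fun y => ∏ i, h (A i ⬝ᵥ y))
    (by simp [h0, hk])
    (fun a y => by simpa [Units.smul_def, dotProduct_smul] using hinv a (fun i => A i ⬝ᵥ y))
  have hfib := AddMonoidHom.card_mul_sum_comp_of_surjective (Matrix.of A).mulVecLin.toAddMonoidHom
    ((Matrix.of A).mulVec_surjective_of_linearIndependent_row hA) (fun w => ∏ i, h (w i))
  have hprod : ∑ w : Fin k → F, ∏ i, h (w i) = (∑ a, h a) ^ k := by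
    simpa using (Finset.prod_univ_sum (fun _ : Fin k => (Finset.univ : Finset F))
      (fun _ a => h a)).symm
  rw [hprod] at hfib
  rw [← hproj]
  simpa [Matrix.mulVec] using hfib

/-- The number of points of a projective space off `k` independent hyperplanes. -/
theorem Projectivization.card_forall_dotProduct_rep_ne_zero {F : Type*} [Field F] [Fintype F]
    [DecidableEq F] {k m : ℕ} [Fintype (ℙ F (Fin m → F))] (hk : k ≠ 0)
    (A : Fin k → Fin m → F) (hA : LinearIndependent F A) :
    (Fintype.card F : ℤ) ^ k * (((Fintype.card F : ℤ) - 1) *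
      (Finset.univ.filter fun p : ℙ F (Fin m → F) => ∀ i, A i ⬝ᵥ p.rep ≠ 0).card) =
      (Fintype.card F : ℤ) ^ m * ((Fintype.card F : ℤ) - 1) ^ k := by
  have key := sum_prod_dotProduct_rep hk A hA (fun a => if a ≠ 0 then 1 else 0) (by simp)
    (by simp)
  have hsum : ∑ a : F, (if a ≠ 0 then 1 else 0 : ℤ) = (Fintype.card F : ℤ) - 1 := by
    rw [Finset.sum_boole, Finset.filter_ne', Finset.card_erase_of_mem (Finset.mem_univ _),
      Finset.card_univ, Nat.cast_sub Fintype.card_pos, Nat.cast_one]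
  rw [hsum] at key
  simp only [Fintype.prod_boole] at key
  rw [← key, Finset.natCast_card_filter]
  congr!

/-- The matrix of quadratic characters of the products of points of the projective plane
over a field of order `q ≡ 3 (mod 4)` is good. -/
theorem isGoodMatrix_quadraticChar_dotProduct {F : Type*} [Field F] [Fintype F] [DecidableEq F]
    (hF : Fintype.card F % 4 = 3) {n : ℕ} (e : Fin n ≃ ℙ F (Fin 3 → F)) :
    IsGoodMatrix (Matrix.of fun i j => quadraticChar F ((e i).rep ⬝ᵥ (e j).rep)) := by
  let _ : Fintype (ℙ F (Fin 3 → F)) := Fintype.ofEquiv _ e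
  obtain ⟨t, ht⟩ : ∃ t, Fintype.card F = 4 * t + 3 := ⟨Fintype.card F / 4, by omega⟩
  have hchar : ringChar F ≠ 2 := fun h => by
    have := FiniteField.even_card_of_char_two h
    omega
  have hq0 : (Fintype.card F : ℤ) ≠ 0 := by rw [ht]; push_cast; omega
  have hq1 : (Fintype.card F : ℤ) - 1 ≠ 0 := by rw [ht]; push_cast; omega
  have hind : ∀ i i', i ≠ i' → LinearIndependent F
      ![(e i).rep, (e i').rep] := by
    intro i i' hii
    rw [← Projectivization.independent_mk_iff_LinearIndependent (e i).rep_nonzero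
      (e i').rep_nonzero, Projectivization.mk_rep, Projectivization.mk_rep,
      Projectivization.independent_pair_iff_ne]
    exact e.injective.ne hii
  have hcard : ∀ P : ℙ F (Fin 3 → F) → Prop, ∀ [DecidablePred P],
      (Finset.univ.filter fun j => P (e j)).card = (Finset.univ.filter P).card := by
    intro P _
    exact Finset.card_equiv e (by simp)
  refine ⟨fun i j => ?_, fun i => ?_, fun i i' hii => ?_, fun i i' hii => ?_⟩
  · have := quadraticChar_isQuadratic F ((e i).rep ⬝ᵥ (e j).rep)
    simp only [Matrix.of_apply]
    tauto
  · have key := Projectivization.card_forall_dotProduct_rep_ne_zero one_ne_zero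
      ![(e i).rep] (by
        rw [linearIndependent_unique_iff]
        exact (e i).rep_nonzero)
    simp only [Fin.forall_fin_one, Matrix.cons_val_zero] at key
    simp only [Matrix.of_apply, ne_eq, quadraticChar_eq_zero_iff]
    rw [hcard (fun p => ¬ (e i).rep ⬝ᵥ p.rep = 0)]
    have hN : ((Finset.univ.filter fun p : ℙ F (Fin 3 → F) => ¬ (e i).rep ⬝ᵥ p.rep = 0).card : ℤ)
        = (Fintype.card F : ℤ) ^ 2 := by
      apply mul_left_cancel₀ (mul_ne_zero hq0 hq1)
      linear_combination key
    have hN' : (Finset.univ.filter fun p : ℙ F (Fin 3 → F) => ¬ (e i).rep ⬝ᵥ p.rep = 0).card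
        = Fintype.card F ^ 2 := by exact_mod_cast hN
    rw [hN']
    exact (Nat.odd_iff.2 (by omega)).pow
  · have key := Projectivization.card_forall_dotProduct_rep_ne_zero two_ne_zero _ (hind i i' hii)
    simp only [Fin.forall_fin_two, Matrix.cons_val_zero,
      Matrix.cons_val_one] at key
    simp only [Matrix.of_apply, ne_eq, quadraticChar_eq_zero_iff]
    rw [hcard (fun p => ¬ (e i).rep ⬝ᵥ p.rep = 0 ∧ ¬ (e i').rep ⬝ᵥ p.rep = 0)]
    have hN : ((Finset.univ.filter fun p : ℙ F (Fin 3 → F) =>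
        ¬ (e i).rep ⬝ᵥ p.rep = 0 ∧ ¬ (e i').rep ⬝ᵥ p.rep = 0).card : ℤ)
        = (Fintype.card F : ℤ) * (Fintype.card F - 1) := by
      apply mul_left_cancel₀ (mul_ne_zero (pow_ne_zero 2 hq0) hq1)
      linear_combination key
    rw [ht] at hN
    push_cast at hN
    have : (4 * (t : ℤ) + 3) * (4 * t + 3 - 1) = 4 * (4 * t ^ 2 + 5 * t + 1) + 2 := by ring
    omega
  · have key := Projectivization.sum_prod_dotProduct_rep two_ne_zero _ (hind i i' hii)
      (quadraticChar F) (by simp) (fun a w => by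
        have := quadraticChar_sq_one (F := F) a.ne_zero
        simp only [map_mul, Fin.prod_univ_two]
        linear_combination (quadraticChar F (w 0) * quadraticChar F (w 1)) * this)
    rw [quadraticChar_sum_zero hchar] at key
    simp only [Fin.prod_univ_two, Matrix.cons_val_zero, Matrix.cons_val_one,
      ne_eq, two_ne_zero, not_false_eq_true, zero_pow, mul_zero, mul_eq_zero, hq0, hq1,
      pow_eq_zero_iff, false_or] at key
    simp only [Matrix.of_apply]
    rw [← key]
    exact e.sum_comp (fun p => quadraticChar F ((e i).rep ⬝ᵥ p.rep) *
      quadraticChar F ((e i').rep ⬝ᵥ p.rep))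

/-- If `q` is a prime power with `q ≡ 3 (mod 4)`, then there is a good matrix of order
`q² + q + 1`. -/
theorem stmt_9 (q : ℕ) (hq : ∃ p r : ℕ, p.Prime ∧ 1 ≤ r ∧ q = p ^ r)
    (hq4 : q % 4 = 3) :
    ∃ M : Matrix (Fin (q ^ 2 + q + 1)) (Fin (q ^ 2 + q + 1)) ℤ, IsGoodMatrix M := by
  classical
  obtain ⟨p, r, hp, hr, hqpr⟩ := hq
  have : Fact p.Prime := ⟨hp⟩
  let _ : Fintype (GaloisField p r) := Fintype.ofFinite _
  have hcard : Nat.card (GaloisField p r) = q := by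
    rw [GaloisField.card p r (by omega), hqpr]
  have hproj : Nat.card (ℙ (GaloisField p r) (Fin 3 → GaloisField p r)) = q ^ 2 + q + 1 := by
    rw [Projectivization.card_of_finrank (n := 3) _ _ (by simp), hcard]
    simp only [Finset.sum_range_succ, Finset.sum_range_zero]
    ring
  exact ⟨_, isGoodMatrix_quadraticChar_dotProduct
    (by rw [← Nat.card_eq_fintype_card, hcard, hq4]) (Finite.equivFinOfCardEq hproj).symm⟩
end

section
/- Let n ≡ 0 (mod 4) and suppose that over GF(2) the polynomial S_n^2(X_1,…,X_n) equals Σ_{i=1}^{n/2} L_i(X_1,…,X_n) R_i(X_1,…,X_n) for homogeneous linear forms L_i, R_i over GF(2). Then there exist homogeneous linear forms L'_i, R'_i in the variables X_1,…,X_{n+1} over GF(2), for 1 ≤ i ≤ n/2, such that S_{n+1}^2(X_1,…,X_{n+1}) = Σ_{i=1}^{n/2} L'_i(X_1,…,X_{n+1}) R'_i(X_1,…,X_{n+1}) over GF(2). -/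
open MvPolynomial

/-- Splitting the pairwise-product sum over `Fin (n + 1)` along the index `0`. -/
theorem sum_lt_mul_succ {A : Type*} [CommRing A] (n : ℕ) (f : Fin (n + 1) → A) :
    ∑ p ∈ Finset.univ.filter (fun p : Fin (n + 1) × Fin (n + 1) => p.1 < p.2), f p.1 * f p.2 =
      f 0 * ∑ i : Fin n, f i.succ +
        ∑ p ∈ Finset.univ.filter (fun p : Fin n × Fin n => p.1 < p.2),
          f p.1.succ * f p.2.succ := by
  simp [Finset.sum_filter, Fintype.sum_prod_type, Fin.sum_univ_succ, Finset.mul_sum]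

/-- The effect on the pairwise-product sum of translating all entries by `y`. -/
theorem sum_lt_mul_add_const {A : Type*} [CommRing A] (n : ℕ) (f : Fin n → A) (y : A) :
    ∑ p ∈ Finset.univ.filter (fun p : Fin n × Fin n => p.1 < p.2),
        (f p.1 + y) * (f p.2 + y) =
      ∑ p ∈ Finset.univ.filter (fun p : Fin n × Fin n => p.1 < p.2), f p.1 * f p.2 +
        ((n : A) - 1) * y * ∑ i, f i + (n.choose 2 : A) * y ^ 2 := by
  induction n with
  | zero => simp
  | succ n ih =>
    rw [sum_lt_mul_succ n (fun i => f i + y), sum_lt_mul_succ n f, ih (fun i => f i.succ),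
      Fin.sum_univ_succ, Finset.sum_add_distrib, Nat.choose_succ_succ' n 1]
    simp only [Finset.sum_const, Finset.card_univ, Fintype.card_fin, nsmul_eq_mul,
      Nat.choose_one_right]
    push_cast
    ring

/-- In characteristic two with `4 ∣ n`, translating the variables of `esym2 n` by a new variable
gives `esym2 (n + 1)`. -/
theorem aeval_esym2_add_X_zero (n : ℕ) (hn : n % 4 = 0) :
    aeval (fun i : Fin n => (X i.succ + X 0 : MvPolynomial (Fin (n + 1)) (ZMod 2)))
      (esym2 (ZMod 2) n) = esym2 (ZMod 2) (n + 1) := by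
  obtain ⟨m, rfl⟩ : ∃ m, n = 4 * m := ⟨n / 4, by omega⟩
  have h_two : (2 : MvPolynomial (Fin (4 * m + 1)) (ZMod 2)) = 0 := CharTwo.two_eq_zero
  have h_choose : (4 * m).choose 2 = 2 * (m * (4 * m - 1)) := by
    rw [Nat.choose_two_right, show 4 * m * (4 * m - 1) = 2 * (2 * (m * (4 * m - 1))) by ring]
    simp
  simp only [esym2, map_sum, map_mul, aeval_X]
  rw [sum_lt_mul_add_const (4 * m) (fun i => X i.succ), sum_lt_mul_succ, h_choose]
  push_cast
  linear_combination
    ((2 * (m : MvPolynomial (Fin (4 * m + 1)) (ZMod 2)) - 1) * X 0 *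
        ∑ i : Fin (4 * m), X i.succ +
      (m : MvPolynomial (Fin (4 * m + 1)) (ZMod 2)) * ((4 * m - 1 : ℕ) :
        MvPolynomial (Fin (4 * m + 1)) (ZMod 2)) * X 0 ^ 2) * h_two

/-- Translating the variables of a linear form by `X 0` gives a linear form. -/
theorem aeval_linearForm_add_X_zero {F : Type*} [CommRing F] (n : ℕ) (a : Fin n → F) :
    aeval (fun i : Fin n => (X i.succ + X 0 : MvPolynomial (Fin (n + 1)) F))
      (∑ k : Fin n, C (a k) * X k) =
      ∑ k : Fin (n + 1), C ((Fin.cons (∑ j, a j) a : Fin (n + 1) → F) k) * X k := by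
  simp [Fin.sum_univ_succ, mul_add, Finset.sum_add_distrib, Finset.sum_mul, algebraMap_eq,
    add_comm]

/-- If `n ≡ 0 (mod 4)` and `S_n^2` over GF(2) is a sum of `n/2` products of pairs of
homogeneous linear forms in `X_1, …, X_n`, then `S_{n+1}^2` over GF(2) is a sum of `n/2`
products of pairs of homogeneous linear forms in `X_1, …, X_{n+1}`. -/
theorem stmt_10 (n : ℕ) (hn : n % 4 = 0)
    (L R : Fin (n / 2) → Fin n → ZMod 2)
    (h : esym2 (ZMod 2) n =
      ∑ i : Fin (n / 2),
        (∑ k : Fin n, C (L i k) * X k) * (∑ k : Fin n, C (R i k) * X k)) :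
    ∃ L' R' : Fin (n / 2) → Fin (n + 1) → ZMod 2,
      esym2 (ZMod 2) (n + 1) =
        ∑ i : Fin (n / 2),
          (∑ k : Fin (n + 1), C (L' i k) * X k) * (∑ k : Fin (n + 1), C (R' i k) * X k) := by
  refine ⟨fun i => Fin.cons (∑ j, L i j) (L i), fun i => Fin.cons (∑ j, R i j) (R i), ?_⟩
  rw [← aeval_esym2_add_X_zero n hn, h, map_sum]
  exact Finset.sum_congr rfl fun i _ => by
    rw [map_mul, aeval_linearForm_add_X_zero, aeval_linearForm_add_X_zero]
end

section
/- Let F be a field of characteristic different from 2 in which -1 has a square root, and let k ≥ 1. Then S_{2k+1}^2(X_1,…,X_{2k+1}) can be written over F as Σ_{i=1}^{k+1} L_i(X) R_i(X) where each L_i, R_i is a homogeneous linear form in X_1,…,X_{2k+1} with coefficients in F. -/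
open MvPolynomial

/-- The square of the sum of the variables, in terms of `esym2` and the sum of squares. -/
theorem two_mul_esym2_add_sum_sq (F : Type*) [CommRing F] (n : ℕ) :
    2 * esym2 F n + ∑ m : Fin n, (X m : MvPolynomial (Fin n) F) ^ 2 =
      (∑ m : Fin n, X m) ^ 2 := by
  have hsplit : ∀ p : Fin n × Fin n, (X p.1 * X p.2 : MvPolynomial (Fin n) F) =
      (if p.1 < p.2 then X p.1 * X p.2 else 0) + (if p.2 < p.1 then X p.2 * X p.1 else 0) +
        (if p.1 = p.2 then X p.1 * X p.2 else 0) := by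
    rintro ⟨a, b⟩
    rcases lt_trichotomy a b with h | h | h
    · simp [h, h.not_gt, h.ne]
    · simp [h]
    · simp [h, h.not_gt, h.ne', mul_comm]
  have hswap : ∑ p : Fin n × Fin n,
      (if p.2 < p.1 then (X p.2 * X p.1 : MvPolynomial (Fin n) F) else 0) = esym2 F n := by
    rw [esym2, Finset.sum_filter, ← (Equiv.prodComm (Fin n) (Fin n)).sum_comp]
    rfl
  have hdiag : ∑ p : Fin n × Fin n,
      (if p.1 = p.2 then (X p.1 * X p.2 : MvPolynomial (Fin n) F) else 0) =
        ∑ m : Fin n, X m ^ 2 := by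
    simp [Fintype.sum_prod_type, sq]
  rw [sq (∑ m : Fin n, X m), Fintype.sum_mul_sum, ← Fintype.sum_prod_type',
    Finset.sum_congr rfl fun p _ => hsplit p, Finset.sum_add_distrib, Finset.sum_add_distrib,
    hswap, hdiag, esym2, Finset.sum_filter]
  ring

/-- A sum over `Fin (2 * k + 1)`, with all indices but the first grouped in consecutive pairs. -/
theorem sum_fin_two_mul_add_one {M : Type*} [AddCommMonoid M] (k : ℕ)
    (f : Fin (2 * k + 1) → M) :
    ∑ m, f m = f 0 + ∑ j : Fin k,
      (f ⟨2 * j + 1, by omega⟩ + f ⟨2 * j + 2, by omega⟩) := by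
  induction k with
  | zero => simp
  | succ k ih =>
    rw [Fin.sum_univ_castSucc (n := k)]
    change ∑ m : Fin (2 * k + 1 + 1 + 1), f m = _
    rw [Fin.sum_univ_castSucc, Fin.sum_univ_castSucc, ih, add_assoc, add_assoc]
    rfl

/-- Over any field of characteristic different from 2 containing a square root of `-1`,
`S_{2k+1}^2` is a sum of `k + 1` products of pairs of homogeneous linear forms. -/
theorem stmt_12 (F : Type*) [Field F] (hchar : (2 : F) ≠ 0)
    (hi : ∃ i : F, i ^ 2 = -1) (k : ℕ) (hk : 1 ≤ k) :
    ∃ L R : Fin (k + 1) → Fin (2 * k + 1) → F,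
      esym2 F (2 * k + 1) =
        ∑ i : Fin (k + 1),
          (∑ m : Fin (2 * k + 1), C (L i m) * X m) *
          (∑ m : Fin (2 * k + 1), C (R i m) * X m) := by
  obtain ⟨r, hr⟩ := hi
  have hform : ∀ (c : F) (a b : Fin (2 * k + 1)),
      ∑ m, C ((Pi.single a 1 + Pi.single b c : Fin (2 * k + 1) → F) m) * X m =
        (X a + C c * X b : MvPolynomial (Fin (2 * k + 1)) F) := by
    intro c a b
    simp [Pi.single_apply, add_mul, Finset.sum_add_distrib, apply_ite C]
  have hformOne : ∀ c : F,
      ∑ m, C ((1 + Pi.single 0 c : Fin (2 * k + 1) → F) m) * X m =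
        (∑ m, X m + C c * X 0 : MvPolynomial (Fin (2 * k + 1)) F) := by
    intro c
    simp [Pi.single_apply, add_mul, Finset.sum_add_distrib, apply_ite C]
  have hsmul : ∀ (c : F) (v : Fin (2 * k + 1) → F),
      ∑ m, C ((c • v) m) * X m =
        (C c * ∑ m, C (v m) * X m : MvPolynomial (Fin (2 * k + 1)) F) := by
    intro c v
    simp [Finset.mul_sum, mul_assoc]
  have hrC : (C r : MvPolynomial (Fin (2 * k + 1)) F) ^ 2 = -1 := by
    rw [← C_pow, hr, C_neg, C_1]
  have hhalf : (C 2⁻¹ : MvPolynomial (Fin (2 * k + 1)) F) * 2 = 1 := by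
    rw [← map_ofNat C 2, ← C_mul, inv_mul_cancel₀ hchar, C_1]
  refine ⟨Fin.cons ((2⁻¹ : F) • (1 + Pi.single 0 (-1))) fun j =>
      (-2⁻¹ : F) • (Pi.single ⟨2 * j + 1, by omega⟩ 1 + Pi.single ⟨2 * j + 2, by omega⟩ r),
    Fin.cons (1 + Pi.single 0 1) fun j =>
      Pi.single ⟨2 * j + 1, by omega⟩ 1 + Pi.single ⟨2 * j + 2, by omega⟩ (-r), ?_⟩
  rw [Fin.sum_univ_succ]
  simp only [Fin.cons_zero, Fin.cons_succ, hsmul, hform, hformOne]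
  have hpair : ∀ a b : Fin (2 * k + 1),
      (C (-2⁻¹) * (X a + C r * X b) * (X a + C (-r) * X b) : MvPolynomial (Fin (2 * k + 1)) F) =
        C (-2⁻¹) * (X a ^ 2 + X b ^ 2) := by
    intro a b
    rw [C_neg (a := r)]
    linear_combination -C (-2⁻¹) * X b ^ 2 * hrC
  simp only [hpair, ← Finset.mul_sum]
  have hsq := two_mul_esym2_add_sum_sq F (2 * k + 1)
  rw [sum_fin_two_mul_add_one k fun m => (X m : MvPolynomial (Fin (2 * k + 1)) F) ^ 2] at hsq
  simp only [C_neg, C_1]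
  linear_combination C 2⁻¹ * hsq - esym2 F (2 * k + 1) * hhalf
end

section
/- Let F be a field of characteristic different from 2 in which -1, 2 and 2k-1 all have square roots, and let k ≥ 1. Then S_{2k}^2(X_1,…,X_{2k}) can be written over F as Σ_{i=1}^{k} L_i(X) R_i(X) where each L_i, R_i is a homogeneous linear form in X_1,…,X_{2k} with coefficients in F. -/
open MvPolynomial

/-- Twice the second elementary symmetric polynomial is the square of the sum of the variables
minus the sum of their squares. -/
lemma two_mul_esym2 (F : Type*) [CommRing F] (n : ℕ) :
    2 * esym2 F n = (∑ m : Fin n, X m) ^ 2 - ∑ m : Fin n, (X m) ^ 2 := by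
  have hsplit : ∀ i j : Fin n, (X i * X j : MvPolynomial (Fin n) F) =
      (if i < j then X i * X j else 0) + (if j < i then X j * X i else 0) +
        (if i = j then X i * X j else 0) := by
    intro i j
    rcases lt_trichotomy i j with h | h | h
    · simp [h, h.ne, h.not_gt]
    · simp [h]
    · simp [h, h.ne', h.not_gt, mul_comm]
  have hesym : esym2 F n = ∑ i : Fin n, ∑ j : Fin n, if i < j then X i * X j else 0 := by
    rw [esym2, Finset.sum_filter, Fintype.sum_prod_type]
  have hsq : (∑ m : Fin n, (X m : MvPolynomial (Fin n) F)) ^ 2 =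
      esym2 F n + esym2 F n + ∑ m : Fin n, (X m) ^ 2 := by
    rw [sq, Finset.sum_mul_sum, Finset.sum_congr rfl fun i _ => Finset.sum_congr rfl
      fun j _ => hsplit i j]
    simp only [Finset.sum_add_distrib]
    congr 1
    · congr 1
      · exact hesym.symm
      · rw [Finset.sum_comm, hesym]
    · simp [sq]
  rw [hsq]
  ring

/-- If `1 - 2a` is a square, the quadratic `a c² + 2 c + 2` has a root, even when `a = 0`. -/
lemma exists_root_of_sq_eq {F : Type*} [Field F] {a d : F}
    (hd : d ^ 2 = 1 - 2 * a) : ∃ c : F, a * c ^ 2 + 2 * c + 2 = 0 := by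
  by_cases ha : a = 0
  · exact ⟨-1, by rw [ha]; ring⟩
  · refine ⟨(-1 + d) / a, ?_⟩
    field_simp
    linear_combination hd

/-- The form `∑ u² - 2 (∑ u)²` becomes a sum of squares after translating each `u j` by a
suitable multiple of `∑ u`. -/
lemma sum_add_mul_sum_sq {R ι : Type*} [CommRing R] [Fintype ι] (u : ι → R) {c : R}
    (hc : (Fintype.card ι : R) * c ^ 2 + 2 * c + 2 = 0) :
    ∑ j, (u j + c * ∑ l, u l) ^ 2 = ∑ j, u j ^ 2 - 2 * (∑ j, u j) ^ 2 := by
  have hexp : ∀ j, (u j + c * ∑ l, u l) ^ 2 =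
      u j ^ 2 + (2 * c * ∑ l, u l) * u j + (c * ∑ l, u l) ^ 2 := fun j => by ring
  simp only [hexp, Finset.sum_add_distrib, ← Finset.mul_sum, Finset.sum_const, Finset.card_univ,
    nsmul_eq_mul]
  linear_combination (∑ l, u l) ^ 2 * hc

/-- Over any field of characteristic different from 2 containing square roots of `-1`, `2`
and `2k - 1`, `S_{2k}^2` is a sum of `k` products of pairs of homogeneous linear forms. -/
theorem stmt_13 (F : Type*) [Field F] (hchar : (2 : F) ≠ 0)
    (hi : ∃ i : F, i ^ 2 = -1) (h2 : ∃ s : F, s ^ 2 = 2)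
    (k : ℕ) (hk : 1 ≤ k)
    (h2k : ∃ t : F, t ^ 2 = ((2 * (k : ℤ) - 1 : ℤ) : F)) :
    ∃ L R : Fin k → Fin (2 * k) → F,
      esym2 F (2 * k) =
        ∑ i : Fin k,
          (∑ m : Fin (2 * k), C (L i m) * X m) *
          (∑ m : Fin (2 * k), C (R i m) * X m) := by
  obtain ⟨ι, hι⟩ := hi
  obtain ⟨t, ht⟩ := h2k
  push_cast at ht
  obtain ⟨c, hc⟩ := exists_root_of_sq_eq (a := (k : F)) (d := ι * t)
    (by rw [mul_pow, hι, ht]; ring)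
  let e : Fin k ⊕ Fin k ≃ Fin (2 * k) := finSumFinEquiv.trans (finCongr (two_mul k).symm)
  let P := MvPolynomial (Fin (2 * k)) F
  let V : Submodule F P := Submodule.span F (Set.range X)
  have hX : ∀ m, (X m : P) ∈ V := fun m => Submodule.subset_span ⟨m, rfl⟩
  have hC : ∀ (a : F) {p : P}, p ∈ V → C a * p ∈ V := fun a p hp => by
    rw [← smul_eq_C_mul]; exact V.smul_mem a hp
  let x : Fin k → P := fun j => X (e (Sum.inl j))
  let y : Fin k → P := fun j => X (e (Sum.inr j))
  let v : Fin k → P := fun j => x j - y j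
  let u : Fin k → P := fun j => x j + y j
  let w : Fin k → P := fun j => u j + C c * ∑ l, u l
  have hv : ∀ j, v j ∈ V := fun j => V.sub_mem (hX _) (hX _)
  have hu : ∀ j, u j ∈ V := fun j => V.add_mem (hX _) (hX _)
  have hw : ∀ j, w j ∈ V := fun j => V.add_mem (hu j) (hC c (V.sum_mem fun l _ => hu l))
  have hcoeff : ∀ p ∈ V, ∃ a : Fin (2 * k) → F, ∑ m, C (a m) * X m = p := fun p hp => by
    obtain ⟨a, rfl⟩ := (Submodule.mem_span_range_iff_exists_fun F).1 hp
    exact ⟨a, Finset.sum_congr rfl fun m _ => (smul_eq_C_mul _ _).symm⟩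
  choose L hL using fun j => hcoeff _ (hC (-(1 / 4)) (V.add_mem (hv j) (hC ι (hw j))))
  choose R hR using fun j => hcoeff _ (V.sub_mem (hv j) (hC ι (hw j)))
  refine ⟨L, R, ?_⟩
  simp only [hL, hR]
  have hCι : (C ι : P) ^ 2 = -1 := by rw [← C_pow, hι]; simp
  have hCc : (Fintype.card (Fin k) : P) * C c ^ 2 + 2 * C c + 2 = 0 := by
    have h := congrArg (C : F → MvPolynomial (Fin (2 * k)) F) hc
    rw [C_add, C_add, C_mul, C_mul, C_pow, map_natCast, map_ofNat, C_0] at h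
    rwa [Fintype.card_fin]
  have hfour : (4 : F) ≠ 0 := by
    rw [show (4 : F) = 2 * 2 by norm_num]; exact mul_ne_zero hchar hchar
  have hC4 : (4 : P) * C (-(1 / 4)) = -1 := by
    rw [show (4 : P) = C 4 from (map_ofNat C 4).symm, ← C_mul,
      show (4 : F) * -(1 / 4) = -1 by field_simp]
    simp
  have hP4 : (4 : P) ≠ 0 := by
    rw [show (4 : P) = C 4 from (map_ofNat C 4).symm]
    exact fun h => hfour (C_eq_zero.1 h)
  have hsum : ∑ m, (X m : P) = ∑ j, u j := by
    rw [← e.sum_comp, Fintype.sum_sum_type, ← Finset.sum_add_distrib]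
  have hsumsq : 2 * ∑ m, (X m : P) ^ 2 = ∑ j, v j ^ 2 + ∑ j, u j ^ 2 := by
    rw [← e.sum_comp, Fintype.sum_sum_type, ← Finset.sum_add_distrib, ← Finset.sum_add_distrib,
      Finset.mul_sum]
    exact Finset.sum_congr rfl fun j _ => by simp only [v, u, x, y]; ring
  have hprod : ∀ j, C (-(1 / 4)) * (v j + C ι * w j) * (v j - C ι * w j) =
      C (-(1 / 4)) * (v j ^ 2 + w j ^ 2) := fun j => by
    linear_combination (-(C (-(1 / 4)) * w j ^ 2)) * hCι
  have hw2 : ∑ j, w j ^ 2 = ∑ j, u j ^ 2 - 2 * (∑ j, u j) ^ 2 := sum_add_mul_sum_sq u hCc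
  have hesym := two_mul_esym2 F (2 * k)
  rw [hsum] at hesym
  simp only [hprod, ← Finset.mul_sum, Finset.sum_add_distrib]
  apply mul_left_cancel₀ hP4
  linear_combination 2 * hesym - hsumsq - (∑ j, v j ^ 2 + ∑ j, w j ^ 2) * hC4 + hw2
end

section
/- Let F be a field, let r ≤ n, and suppose S_n^2(X) = Σ_{i=1}^r Π_{j=1}^{s_i} L_{ij}(X) over F, where each L_{ij} is an affine linear form in X_1,…,X_n. Then there exist homogeneous linear forms ℓ_1,…,ℓ_r in the variables X_1,…,X_{n-r} over F such that S_n^2(X_1,…,X_{n-r}, ℓ_1,…,ℓ_r) = 0 as a polynomial in X_1,…,X_{n-r}. -/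
open MvPolynomial

/-- Given finitely many families of affine functions, there is an affine subspace `v + W` whose
codimension is at most the number of families, such that each family either has a member vanishing
on `v + W` or consists of functions constant on `v + W`. -/
theorem exists_affine_subspace_constant_products {F V ι : Type*} [Field F] [AddCommGroup V]
    [Module F V] [FiniteDimensional F V] (κ : ι → Type*) (c : (i : ι) → κ i → F)
    (f : (i : ι) → κ i → Module.Dual F V) (S : Finset ι) :
    ∃ (v : V) (W : Submodule F V), Module.finrank F V ≤ Module.finrank F W + S.card ∧
      ∀ i ∈ S, (∃ j, c i j + f i j v = 0 ∧ ∀ w ∈ W, f i j w = 0) ∨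
        ∀ j, ∀ w ∈ W, f i j w = 0 := by
  classical
  induction S using Finset.induction_on with
  | empty => exact ⟨0, ⊤, by simp, by simp⟩
  | insert i S hi ih =>
    obtain ⟨v, W, hW, hS⟩ := ih
    by_cases hconst : ∀ j, ∀ w ∈ W, f i j w = 0
    · refine ⟨v, W, by rw [Finset.card_insert_of_notMem hi]; omega, fun k hk => ?_⟩
      rcases Finset.mem_insert.mp hk with rfl | hk
      · exact Or.inr hconst
      · exact hS k hk
    · push Not at hconst
      obtain ⟨j, w₀, hw₀, hne⟩ := hconst
      refine ⟨v + (-(c i j + f i j v) / f i j w₀) • w₀, W ⊓ LinearMap.ker (f i j), ?_,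
        fun k hk => ?_⟩
      · rw [Finset.card_insert_of_notMem hi]
        have h₁ := Submodule.finrank_sup_add_finrank_inf_eq W (LinearMap.ker (f i j))
        have h₂ := Submodule.finrank_le (W ⊔ LinearMap.ker (f i j))
        have h₃ := (f i j).finrank_range_add_finrank_ker
        have h₄ := Submodule.finrank_le (LinearMap.range (f i j))
        rw [Module.finrank_self] at h₄
        omega
      · rcases Finset.mem_insert.mp hk with rfl | hk
        · refine Or.inl ⟨j, ?_, fun w hw => hw.2⟩
          simp only [map_add, map_smul, smul_eq_mul]
          field_simp
          ring
        · rcases hS k hk with ⟨l, hl, hlW⟩ | hall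
          · refine Or.inl ⟨l, ?_, fun w hw => hlW w hw.1⟩
            simp [hlW w₀ hw₀, hl]
          · exact Or.inr fun l w hw => hall l w hw.1

/-- A subspace of `F^n` of dimension at least `d` projects onto some `d` coordinates. -/
theorem exists_perm_dual_coordinates {F : Type*} [Field F] {n d : ℕ}
    (W : Submodule F (Fin n → F)) (hd : d ≤ Module.finrank F W) (hdn : d ≤ n) :
    ∃ (σ : Equiv.Perm (Fin n)) (w : Fin d → Fin n → F), (∀ k, w k ∈ W) ∧
      ∀ k l : Fin d, w k (σ (Fin.castLE hdn l)) = if l = k then 1 else 0 := by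
  let φ : Fin n → Module.Dual F W := fun i => (LinearMap.proj i).comp W.subtype
  have htop : Submodule.span F (Set.range φ) = ⊤ := by
    refine Submodule.span_eq_top_of_ne_zero fun w hw => ?_
    by_contra! hzero
    refine hw (Subtype.ext (funext fun i => ?_))
    exact hzero (φ i) ⟨i, rfl⟩
  obtain ⟨f, hf, hspan, hind⟩ := Submodule.exists_fun_fin_finrank_span_eq F (Set.range φ)
  choose e he using hf
  have hdim : Module.finrank F (Submodule.span F (Set.range φ)) = Module.finrank F W := by
    rw [htop, finrank_top, Subspace.dual_finrank_eq]
  have hd' : d ≤ Module.finrank F (Submodule.span F (Set.range φ)) := hdim ▸ hd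
  have hinj : Function.Injective e := fun i j hij => hind.injective (by rw [← he, ← he, hij])
  let b := Module.Basis.mk hind (by rw [hspan, htop])
  obtain ⟨σ, hσ⟩ := Equiv.Perm.exists_extending_pair (Fin.castLE hdn) (e ∘ Fin.castLE hd')
    (Fin.castLE_injective hdn) (hinj.comp (Fin.castLE_injective hd'))
  refine ⟨σ, fun k => ((Module.evalEquiv F W).symm (b.dualBasis (Fin.castLE hd' k)) : W),
    fun k => Subtype.coe_prop _, fun k l => ?_⟩
  rw [hσ]
  change φ (e (Fin.castLE hd' l)) _ = _
  rw [he, Module.apply_evalEquiv_symm_apply]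
  have hb : f (Fin.castLE hd' l) = b (Fin.castLE hd' l) := by simp [b]
  rw [hb, b.dualBasis_apply_self]
  simp

theorem eval_esym2 {F : Type*} [CommRing F] {n : ℕ} (w : Fin n → F) :
    eval w (esym2 F n) =
      ∑ p ∈ Finset.univ.filter (fun p : Fin n × Fin n => p.1 < p.2), w p.1 * w p.2 := by
  simp [esym2]

theorem eval_esym2_comp_perm {F : Type*} [CommRing F] {n : ℕ} (w : Fin n → F)
    (σ : Equiv.Perm (Fin n)) : eval (w ∘ σ) (esym2 F n) = eval w (esym2 F n) := by
  rw [eval_esym2, eval_esym2]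
  refine Finset.sum_bij' (fun p _ => (min (σ p.1) (σ p.2), max (σ p.1) (σ p.2)))
    (fun p _ => (min (σ.symm p.1) (σ.symm p.2), max (σ.symm p.1) (σ.symm p.2))) ?_ ?_ ?_ ?_ ?_
  · intro p hp
    simpa using (Finset.mem_filter.mp hp).2.ne'
  · intro p hp
    simpa using (Finset.mem_filter.mp hp).2.ne'
  · rintro ⟨i, j⟩ hp
    have hij : i < j := (Finset.mem_filter.mp hp).2
    rcases le_total (σ i) (σ j) with h | h <;> simp [h, hij.le]
  · rintro ⟨i, j⟩ hp
    have hij : i < j := (Finset.mem_filter.mp hp).2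
    rcases le_total (σ.symm i) (σ.symm j) with h | h <;> simp [h, hij.le]
  · rintro ⟨i, j⟩ -
    rcases le_total (σ i) (σ j) with h | h <;> simp [h, mul_comm]

/-- If `S_n^2` takes a constant value on the line `v + t w`, as a polynomial in `t`, then it
vanishes at the direction `w`. -/
theorem eval_esym2_eq_zero_of_line {F : Type*} [Field F] {n : ℕ} (v w : Fin n → F) (b : F)
    (h : aeval (fun k => Polynomial.C (v k) + Polynomial.C (w k) * Polynomial.X) (esym2 F n) =
      Polynomial.C b) : eval w (esym2 F n) = 0 := by
  have h2 := congrArg (fun q => Polynomial.coeff q 2) h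
  rw [eval_esym2]
  simp only [esym2, map_sum, map_mul, aeval_X, Polynomial.finsetSum_coeff] at h2
  rw [Polynomial.coeff_C_of_ne_zero two_ne_zero] at h2
  rw [← h2]
  refine Finset.sum_congr rfl fun p _ => ?_
  have : (Polynomial.C (v p.1) + Polynomial.C (w p.1) * Polynomial.X) *
      (Polynomial.C (v p.2) + Polynomial.C (w p.2) * Polynomial.X) =
      Polynomial.C (v p.1 * v p.2) + Polynomial.C (v p.1 * w p.2 + w p.1 * v p.2) * Polynomial.X +
      Polynomial.C (w p.1 * w p.2) * Polynomial.X ^ 2 := by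
    simp only [map_add, map_mul]; ring
  rw [this, Polynomial.coeff_add, Polynomial.coeff_add, Polynomial.coeff_C_of_ne_zero two_ne_zero,
    Polynomial.coeff_C_mul_X, Polynomial.coeff_C_mul_X_pow]
  simp

/-- The quadratic form of an alternating matrix is zero. -/
theorem sum_mul_alternating_eq_zero {R κ : Type*} [CommRing R] [Fintype κ]
    (x : κ → R) (B : κ → κ → R) (hdiag : ∀ k, B k k = 0) (hskew : ∀ k l, B k l + B l k = 0) :
    ∑ p : κ × κ, x p.1 * x p.2 * B p.1 p.2 = 0 := by
  classical
  refine Finset.sum_involution (fun p _ => p.swap) ?_ ?_ ?_ ?_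
  · rintro ⟨k, l⟩ -
    dsimp only [Prod.swap]
    linear_combination x k * x l * hskew k l
  · rintro ⟨k, l⟩ - hne heq
    obtain rfl : l = k := congrArg Prod.fst heq
    simp [hdiag] at hne
  · simp
  · simp

/-- If `S_n^2` vanishes on all pairwise sums of the vectors `u k` and on the vectors themselves,
then it vanishes identically on the generic linear combination of the `u k`. -/
theorem aeval_esym2_linear_combination {F : Type*} [CommRing F] {n d : ℕ}
    (u : Fin d → Fin n → F) (hu : ∀ k, eval (u k) (esym2 F n) = 0)
    (huv : ∀ k l, eval (u k + u l) (esym2 F n) = 0) :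
    aeval (fun i => ∑ k, C (u k i) * (X k : MvPolynomial (Fin d) F)) (esym2 F n) = 0 := by
  simp only [eval_esym2] at hu huv
  rw [← sum_mul_alternating_eq_zero (fun k => (X k : MvPolynomial (Fin d) F))
    (fun k l => C (∑ p ∈ Finset.univ.filter (fun p : Fin n × Fin n => p.1 < p.2),
      u k p.1 * u l p.2)) (fun k => by rw [hu, C_0]) (fun k l => ?_)]
  · simp only [esym2, map_sum, map_mul, aeval_X, Finset.mul_sum (Finset.univ.filter _)]
    rw [Finset.sum_comm]
    refine Finset.sum_congr rfl fun p _ => ?_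
    rw [Fintype.sum_prod_type, Finset.sum_mul_sum]
    exact Finset.sum_congr rfl fun k _ => Finset.sum_congr rfl fun l _ => by ring
  · rw [← C_add, ← C_0]
    congr 1
    have h := huv k l
    simp only [Pi.add_apply, add_mul, mul_add, Finset.sum_add_distrib, hu, zero_add,
      add_zero] at h
    rw [← h, add_comm]

/-- If a (possibly inhomogeneous) ΣΠΣ circuit with `r ≤ n` multiplication gates computes
`S_n^2` over a field `F`, then there are homogeneous linear forms `ℓ_1, …, ℓ_r` in the
variables `X_1, …, X_{n-r}` with `S_n^2(X_1, …, X_{n-r}, ℓ_1, …, ℓ_r) = 0`. -/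
theorem stmt_14 (F : Type*) [Field F] (n r : ℕ) (hr : r ≤ n) (s : Fin r → ℕ)
    (c : (i : Fin r) → Fin (s i) → F)
    (a : (i : Fin r) → Fin (s i) → Fin n → F)
    (h : esym2 F n =
      ∑ i : Fin r, ∏ j : Fin (s i), (C (c i j) + ∑ k : Fin n, C (a i j k) * X k)) :
    ∃ ℓ : Fin r → Fin (n - r) → F,
      aeval (fun i : Fin n =>
          if h' : (i : ℕ) < n - r then (X ⟨i, h'⟩ : MvPolynomial (Fin (n - r)) F)
          else ∑ k : Fin (n - r),
            C (ℓ ⟨(i : ℕ) - (n - r), by have := i.isLt; omega⟩ k) * X k)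
        (esym2 F n) = 0 := by
  obtain ⟨v, W, hdim, hgate⟩ := exists_affine_subspace_constant_products
    (fun i => Fin (s i)) c (fun i j => Fintype.linearCombination F (a i j)) Finset.univ
  simp only [Module.finrank_fin_fun, Finset.card_univ, Fintype.card_fin] at hdim
  have hW : ∀ w ∈ W, eval w (esym2 F n) = 0 := by
    intro w hw
    have hfactor : ∀ i j,
        aeval (fun k => Polynomial.C (v k) + Polynomial.C (w k) * Polynomial.X)
          (C (c i j) + ∑ k : Fin n, C (a i j k) * X k) =
        Polynomial.C (c i j + Fintype.linearCombination F (a i j) v) +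
          Polynomial.C (Fintype.linearCombination F (a i j) w) * Polynomial.X := by
      intro i j
      simp only [map_add, map_sum, map_mul, aeval_C, aeval_X, Fintype.linearCombination_apply,
        smul_eq_mul, Polynomial.algebraMap_eq, mul_add, Finset.sum_add_distrib, Finset.sum_mul,
        add_assoc]
      congr 2 <;> exact Finset.sum_congr rfl fun k _ => by ring
    have hconst : ∀ i, ∃ b, aeval (fun k => Polynomial.C (v k) + Polynomial.C (w k) * Polynomial.X)
        (∏ j : Fin (s i), (C (c i j) + ∑ k : Fin n, C (a i j k) * X k)) = Polynomial.C b := by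
      intro i
      simp only [map_prod, hfactor]
      rcases hgate i (Finset.mem_univ i) with ⟨j, hj, hjW⟩ | hall
      · exact ⟨0, by rw [map_zero]; exact
          Finset.prod_eq_zero (Finset.mem_univ j) (by rw [hj, hjW w hw]; simp)⟩
      · exact ⟨∏ j, (c i j + Fintype.linearCombination F (a i j) v), by
          simp [fun j => hall j w hw, map_prod]⟩
    choose b hb using hconst
    refine eval_esym2_eq_zero_of_line v w (∑ i, b i) ?_
    rw [h, map_sum, map_sum]
    exact Finset.sum_congr rfl fun i _ => hb i
  obtain ⟨σ, w, hwW, hdual⟩ := exists_perm_dual_coordinates W (d := n - r) (by omega) (by omega)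
  refine ⟨fun i k => w k (σ ⟨n - r + i, by omega⟩), ?_⟩
  rw [← aeval_esym2_linear_combination (fun k => w k ∘ σ)
    (fun k => by rw [eval_esym2_comp_perm]; exact hW _ (hwW k))
    (fun k l => by
      have := eval_esym2_comp_perm (w k + w l) σ
      rw [hW _ (W.add_mem (hwW k) (hwW l))] at this
      exact this)]
  congr 2
  funext i
  split_ifs with hi
  · have hi' : ∀ k, w k (σ i) = if (⟨i, hi⟩ : Fin (n - r)) = k then 1 else 0 := fun k =>
      hdual k ⟨i, hi⟩
    simp [hi']
  · have hi' : (⟨n - r + (i - (n - r)), by omega⟩ : Fin n) = i := Fin.ext (by simp; omega)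
    simp [hi']
end

section
/- Let r ≤ n and suppose ℓ_1,…,ℓ_r are homogeneous linear forms in the variables X_1,…,X_{n-r} over GF(2) such that S_n^2(X_1,…,X_{n-r}, ℓ_1,…,ℓ_r) = 0 as a polynomial over GF(2). Then r ≥ ⌊n/2⌋; moreover, if n ≡ 3 (mod 4), then r ≥ ⌈n/2⌉. -/
open MvPolynomial

theorem dotProductBilin_nondegenerate {K ι : Type*} [Field K] [Fintype ι] :
    LinearMap.BilinForm.Nondegenerate (dotProductBilin K K : (ι → K) →ₗ[K] (ι → K) →ₗ[K] K) :=
  LinearMap.BilinForm.Nondegenerate.ofSeparatingLeft fun v hv => dotProduct_eq_zero v hv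

/-- A totally isotropic subspace for the dot product has at most half the dimension. -/
theorem two_mul_finrank_le_of_dotProduct_eq_zero {K ι : Type*} [Field K] [Fintype ι]
    (W : Submodule K (ι → K)) (hW : ∀ u ∈ W, ∀ v ∈ W, u ⬝ᵥ v = 0) :
    2 * Module.finrank K W ≤ Fintype.card ι := by
  have hle : W ≤ LinearMap.BilinForm.orthogonal (dotProductBilin K K) W :=
    fun v hv u hu => hW u hu v hv
  have hdim := LinearMap.BilinForm.finrank_orthogonal
    (dotProductBilin_nondegenerate (K := K) (ι := ι)) W
  have hmono := Submodule.finrank_mono hle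
  have hW' := Submodule.finrank_le W
  rw [Module.finrank_fintype_fun_eq_card] at hdim hW'
  omega

/-- A self-dual binary code contains the all-ones vector. -/
theorem one_mem_of_two_mul_finrank_eq {ι : Type*} [Fintype ι]
    (W : Submodule (ZMod 2) (ι → ZMod 2)) (hW : ∀ u ∈ W, ∀ v ∈ W, u ⬝ᵥ v = 0)
    (hcard : 2 * Module.finrank (ZMod 2) W = Fintype.card ι) : 1 ∈ W := by
  have hle : W ≤ LinearMap.BilinForm.orthogonal (dotProductBilin (ZMod 2) (ZMod 2)) W :=
    fun v hv u hu => hW u hu v hv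
  have hdim := LinearMap.BilinForm.finrank_orthogonal
    (dotProductBilin_nondegenerate (K := ZMod 2) (ι := ι)) W
  rw [Module.finrank_fintype_fun_eq_card] at hdim
  rw [Submodule.eq_of_le_of_finrank_eq hle (by omega)]
  intro u hu
  have hsq : ∀ a : ZMod 2, a * 1 = a * a := by decide
  change u ⬝ᵥ 1 = 0
  rw [← hW u hu u hu]
  exact Finset.sum_congr rfl fun i _ => hsq (u i)

/-- The value of the second elementary symmetric polynomial at `v`. -/
def pairSum {R : Type*} [CommSemiring R] {n : ℕ} (v : Fin n → R) : R :=
  ∑ p ∈ Finset.univ.filter (fun p : Fin n × Fin n => p.1 < p.2), v p.1 * v p.2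

theorem pairSum_polarization {R : Type*} [CommRing R] {n : ℕ} (u v : Fin n → R) :
    pairSum (u + v) + u ⬝ᵥ v = pairSum u + pairSum v + (∑ i, u i) * ∑ i, v i := by
  have hflip : ∑ i : Fin n, ∑ j : Fin n, (if i < j then u j * v i else 0) =
      ∑ i : Fin n, ∑ j : Fin n, if j < i then u i * v j else 0 := Finset.sum_comm
  have hdot : u ⬝ᵥ v = ∑ i : Fin n, ∑ j : Fin n, if i = j then u i * v j else 0 := by
    simp [dotProduct]
  have hsplit : ∑ i : Fin n, ∑ j : Fin n, u i * v j =
      (∑ i : Fin n, ∑ j : Fin n, if i < j then u i * v j else 0) +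
        (∑ i : Fin n, ∑ j : Fin n, if i = j then u i * v j else 0) +
        ∑ i : Fin n, ∑ j : Fin n, if j < i then u i * v j else 0 := by
    simp only [← Finset.sum_add_distrib]
    refine Finset.sum_congr rfl fun i _ => Finset.sum_congr rfl fun j _ => ?_
    rcases lt_trichotomy i j with hij | rfl | hij
    · simp [hij, hij.ne, hij.not_gt]
    · simp
    · simp [hij, hij.ne', hij.not_gt]
  rw [Finset.sum_mul_sum, hsplit, ← hflip, hdot, ← add_assoc, ← add_assoc]
  simp only [pairSum, Finset.sum_filter, Fintype.sum_prod_type, ← Finset.sum_add_distrib,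
    Pi.add_apply]
  refine Finset.sum_congr rfl fun i _ => Finset.sum_congr rfl fun j _ => ?_
  split_ifs <;> ring

theorem pairSum_one_ne_zero {n : ℕ} (hn : n % 4 = 3) : pairSum (1 : Fin n → ZMod 2) ≠ 0 := by
  have hcast : pairSum (1 : Fin n → ZMod 2) = ((pairSum (1 : Fin n → ℤ) : ℤ) : ZMod 2) := by
    simp [pairSum]
  have hdouble : pairSum (1 + 1 : Fin n → ℤ) = 4 * pairSum (1 : Fin n → ℤ) := by
    simp [pairSum]
    ring
  have hpol := pairSum_polarization (1 : Fin n → ℤ) 1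
  rw [hdouble] at hpol
  simp only [dotProduct, Pi.one_apply, mul_one, Finset.sum_const, Finset.card_univ,
    Fintype.card_fin, nsmul_eq_mul] at hpol
  obtain ⟨k, rfl⟩ : ∃ k, n = 4 * k + 3 := ⟨n / 4, by omega⟩
  rw [hcast, Ne, ZMod.intCast_zmod_eq_zero_iff_dvd]
  rintro ⟨c, hc⟩
  push_cast at hpol hc
  rw [hc] at hpol
  have : 2 * (c - 4 * (k : ℤ) ^ 2 - 5 * k) = 3 := by nlinarith
  omega

/-- Appending the coordinate sum to a vector. -/
def parityExtension (R : Type*) [CommSemiring R] (n : ℕ) :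
    (Fin n → R) →ₗ[R] (Fin (n + 1) → R) where
  toFun v := Fin.cons (∑ i, v i) v
  map_add' u v := by
    ext i
    cases i using Fin.cases <;> simp [Finset.sum_add_distrib]
  map_smul' a v := by
    ext i
    cases i using Fin.cases <;> simp [Finset.mul_sum]

theorem parityExtension_injective (R : Type*) [CommSemiring R] (n : ℕ) :
    Function.Injective (parityExtension R n) := fun u v h => by
  ext i
  simpa [parityExtension] using congrFun h i.succ

theorem parityExtension_dotProduct {n : ℕ} {u v : Fin n → ZMod 2} (hu : pairSum u = 0)
    (hv : pairSum v = 0) (huv : pairSum (u + v) = 0) :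
    parityExtension (ZMod 2) n u ⬝ᵥ parityExtension (ZMod 2) n v = 0 := by
  have h := pairSum_polarization u v
  rw [hu, hv, huv, zero_add, zero_add, zero_add] at h
  have : parityExtension (ZMod 2) n u ⬝ᵥ parityExtension (ZMod 2) n v =
      (∑ i, u i) * (∑ i, v i) + u ⬝ᵥ v := by
    simp [parityExtension, dotProduct, Fin.sum_univ_succ]
  rw [this, h, CharTwo.add_self_eq_zero]

/-- Dimension bounds for binary subspaces on which the second elementary symmetric polynomial
vanishes. -/
theorem two_mul_finrank_le_of_pairSum_eq_zero {n : ℕ} (V : Submodule (ZMod 2) (Fin n → ZMod 2))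
    (hV : ∀ v ∈ V, pairSum v = 0) :
    2 * Module.finrank (ZMod 2) V ≤ n + 1 ∧
      (n % 4 = 3 → 2 * Module.finrank (ZMod 2) V ≠ n + 1) := by
  have hiso : ∀ u ∈ V.map (parityExtension (ZMod 2) n), ∀ v ∈ V.map (parityExtension (ZMod 2) n),
      u ⬝ᵥ v = 0 := by
    rintro _ ⟨u, hu, rfl⟩ _ ⟨v, hv, rfl⟩
    exact parityExtension_dotProduct (hV u hu) (hV v hv) (hV _ (V.add_mem hu hv))
  have hdim : Module.finrank (ZMod 2) (V.map (parityExtension (ZMod 2) n)) =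
      Module.finrank (ZMod 2) V :=
    (Submodule.equivMapOfInjective _ (parityExtension_injective _ n) V).finrank_eq.symm
  refine ⟨?_, fun hn heq => ?_⟩
  · simpa [hdim] using two_mul_finrank_le_of_dotProduct_eq_zero _ hiso
  · obtain ⟨v, hv, hv1⟩ := one_mem_of_two_mul_finrank_eq _ hiso (by simpa [hdim] using heq)
    have : v = 1 := by
      ext i
      simpa [parityExtension] using congrFun hv1 i.succ
    exact pairSum_one_ne_zero hn (this ▸ hV v hv)

/-- If `ℓ_1, …, ℓ_r` are homogeneous linear forms in `X_1, …, X_{n-r}` over GF(2) such that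
`S_n^2(X_1, …, X_{n-r}, ℓ_1, …, ℓ_r) = 0`, then `r ≥ ⌊n/2⌋`; moreover, if `n ≡ 3 (mod 4)`
then `r ≥ ⌈n/2⌉`. -/
theorem stmt_15 (n r : ℕ) (hr : r ≤ n) (ℓ : Fin r → Fin (n - r) → ZMod 2)
    (h : aeval (fun i : Fin n =>
        if h' : (i : ℕ) < n - r then (X ⟨i, h'⟩ : MvPolynomial (Fin (n - r)) (ZMod 2))
        else ∑ k : Fin (n - r),
          C (ℓ ⟨(i : ℕ) - (n - r), by have := i.isLt; omega⟩ k) * X k)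
      (esym2 (ZMod 2) n) = 0) :
    n / 2 ≤ r ∧ (n % 4 = 3 → (n + 1) / 2 ≤ r) := by
  let A : Matrix (Fin n) (Fin (n - r)) (ZMod 2) := fun i k =>
    if h' : (i : ℕ) < n - r then (Pi.single ⟨i, h'⟩ 1 : Fin (n - r) → ZMod 2) k
    else ℓ ⟨(i : ℕ) - (n - r), by have := i.isLt; omega⟩ k
  have hA : ∀ x (i : Fin n), A.mulVecLin x i = if h' : (i : ℕ) < n - r then x ⟨i, h'⟩
      else ∑ k, ℓ ⟨(i : ℕ) - (n - r), by have := i.isLt; omega⟩ k * x k := by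
    intro x i
    change ∑ k, A i k * x k = _
    by_cases hi : (i : ℕ) < n - r <;> simp [A, hi, Pi.single_apply]
  have hinj : Function.Injective A.mulVecLin := by
    intro x y hxy
    ext k
    have hk := congrFun hxy ⟨k, by omega⟩
    simpa only [hA, k.isLt, dif_pos] using hk
  have hV : ∀ v ∈ LinearMap.range A.mulVecLin, pairSum v = 0 := by
    rintro _ ⟨x, rfl⟩
    have hx := congrArg (eval x) h
    simp only [esym2, map_sum, map_mul, aeval_X, map_zero] at hx
    rw [← hx]
    refine Finset.sum_congr rfl fun p _ => ?_
    congr 1 <;>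
    · rw [hA]
      split_ifs <;> simp
  have hdim : Module.finrank (ZMod 2) (LinearMap.range A.mulVecLin) = n - r := by
    rw [LinearMap.finrank_range_of_inj hinj, Module.finrank_fintype_fun_eq_card, Fintype.card_fin]
  obtain ⟨h₁, h₂⟩ := two_mul_finrank_le_of_pairSum_eq_zero _ hV
  rw [hdim] at h₁ h₂
  refine ⟨by omega, fun hn => ?_⟩
  have := h₂ hn
  omega
end

section
/- Let F be a field, let k ≥ 1, and suppose the image of k in F (under the canonical map ℤ → F) is nonzero. Then for any k − 1 homogeneous linear forms ℓ_1,…,ℓ_{k-1} in the variables X_1,…,X_{k+1} over F, the polynomial S_{2k}^2(X_1,…,X_{k+1}, ℓ_1,…,ℓ_{k-1}) is not the zero polynomial. -/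
open MvPolynomial

/-- The polar form of `∑_{i < j} x_i x_j` is `(∑ x_i) (∑ y_i) - ∑ x_i y_i`. -/
theorem eval_esym2_add {F : Type*} [CommRing F] {n : ℕ} (x y : Fin n → F) :
    eval (x + y) (esym2 F n) =
      eval x (esym2 F n) + eval y (esym2 F n) + ((∑ i, x i) * (∑ i, y i) - ∑ i, x i * y i) := by
  have key : (∑ i, x i) * (∑ i, y i) = (∑ i, ∑ j, if i < j then x i * y j else 0)
      + (∑ i, ∑ j, if i < j then x j * y i else 0) + ∑ i, x i * y i := by
    rw [Finset.sum_comm (f := fun i j => if i < j then x j * y i else 0), Finset.sum_mul_sum,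
      ← Finset.sum_add_distrib, ← Finset.sum_add_distrib]
    refine Finset.sum_congr rfl fun i _ => ?_
    have diag : x i * y i = ∑ j, if i = j then x i * y j else 0 := by simp
    rw [diag, ← Finset.sum_add_distrib, ← Finset.sum_add_distrib]
    refine Finset.sum_congr rfl fun j _ => ?_
    rcases lt_trichotomy i j with h | h | h
    · simp [h, h.not_gt, h.ne]
    · simp [h]
    · simp [h, h.not_gt, h.ne']
  rw [key, add_sub_cancel_right]
  simp only [esym2, map_sum, map_mul, eval_X, Pi.add_apply]
  simp only [Finset.sum_filter, Fintype.sum_prod_type]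
  simp only [← Finset.sum_add_distrib]
  refine Finset.sum_congr rfl fun i _ => Finset.sum_congr rfl fun j _ => ?_
  split_ifs <;> ring

/-- If the image of `k` in a field `F` is nonzero, then for any `k - 1` homogeneous linear
forms `ℓ_1, …, ℓ_{k-1}` in `X_1, …, X_{k+1}`, the polynomial
`S_{2k}^2(X_1, …, X_{k+1}, ℓ_1, …, ℓ_{k-1})` is nonzero. -/
theorem stmt_16 (F : Type*) [Field F] (k : ℕ) (hk : 1 ≤ k) (hkF : (k : F) ≠ 0)
    (ℓ : Fin (k - 1) → Fin (k + 1) → F) :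
    aeval (fun i : Fin (2 * k) =>
        if h' : (i : ℕ) < k + 1 then (X ⟨i, h'⟩ : MvPolynomial (Fin (k + 1)) F)
        else ∑ m : Fin (k + 1),
          C (ℓ ⟨(i : ℕ) - (k + 1), by have := i.isLt; omega⟩ m) * X m)
      (esym2 F (2 * k)) ≠ 0 := by
  intro h0
  let T : (Fin (k + 1) → F) →ₗ[F] (Fin (2 * k) → F) := LinearMap.pi fun i =>
    if h' : (i : ℕ) < k + 1 then LinearMap.proj ⟨i, h'⟩
    else ∑ m : Fin (k + 1),
      ℓ ⟨(i : ℕ) - (k + 1), by have := i.isLt; omega⟩ m • LinearMap.proj m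
  have isotropic (v : Fin (k + 1) → F) : eval (T v) (esym2 F (2 * k)) = 0 := by
    have h := congrArg (aeval v) h0
    rw [← AlgHom.comp_apply, comp_aeval, map_zero] at h
    rw [← h, ← aeval_eq_eval]
    congr 2
    funext i
    simp only [T, LinearMap.pi_apply]
    split_ifs <;> simp
  have polar (v w : Fin (k + 1) → F) : (∑ i, T v i) * (∑ i, T w i) = ∑ i, T v i * T w i := by
    have h := eval_esym2_add (T v) (T w)
    rw [← map_add, isotropic, isotropic, isotropic] at h
    linear_combination -h
  -- `k` linear conditions: the coordinate sum of `T v` and the `k - 1` forms vanish.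
  let G : (Fin (k + 1) → F) →ₗ[F] F × (Fin (k - 1) → F) :=
    ((∑ i, LinearMap.proj i) ∘ₗ T).prod
      (LinearMap.pi fun a => LinearMap.proj ⟨a + (k + 1), by have := a.isLt; omega⟩ ∘ₗ T)
  have hG : LinearMap.ker G ≠ ⊥ := by
    apply LinearMap.ker_ne_bot_of_finrank_lt
    simp
    omega
  obtain ⟨v, hv, hv0⟩ := (Submodule.ne_bot_iff _).1 hG
  have hsum : ∑ i, T v i = 0 := by
    simpa [G] using congrArg Prod.fst (LinearMap.mem_ker.1 hv)
  have hform (i : Fin (2 * k)) (hi : ¬ (i : ℕ) < k + 1) : T v i = 0 := by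
    have h := congrFun (congrArg Prod.snd (LinearMap.mem_ker.1 hv))
      ⟨(i : ℕ) - (k + 1), by have := i.isLt; omega⟩
    have e : (⟨(i : ℕ) - (k + 1) + (k + 1), by have := i.isLt; omega⟩ : Fin (2 * k)) = i :=
      Fin.ext (by simp; omega)
    rw [← e]
    exact h
  have hcoord (w : Fin (k + 1) → F) (i : Fin (2 * k)) (hi : (i : ℕ) < k + 1) :
      T w i = w ⟨i, hi⟩ := by
    simp only [T, LinearMap.pi_apply, dif_pos hi, LinearMap.proj_apply]
  refine hv0 (funext fun j => ?_)
  have h := polar v (Pi.single j 1)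
  rw [hsum, zero_mul, Finset.sum_eq_single ⟨j, by have := j.isLt; omega⟩] at h
  · rw [hcoord _ _ j.isLt, hcoord _ _ j.isLt] at h
    simpa using h.symm
  · intro i _ hij
    by_cases hi : (i : ℕ) < k + 1
    · have hne : (⟨i, hi⟩ : Fin (k + 1)) ≠ j := fun e => hij (Fin.ext (by simp [← e]))
      rw [hcoord _ _ hi, hcoord _ _ hi, Pi.single_eq_of_ne hne, mul_zero]
    · rw [hform i hi, zero_mul]
  · simp
end

section
/- Let F be a field of characteristic different from 2, let k ≥ 1, and suppose the image of k in F (under the canonical map ℤ → F) is not equal to -1. Then for any k − 1 homogeneous linear forms ℓ_1,…,ℓ_{k-1} in the variables X_1,…,X_{k+1} over F, the polynomial S_{2k}^2(X_1,…,X_{k+1}, ℓ_1,…,ℓ_{k-1}) is not the zero polynomial. -/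
open MvPolynomial

/-- Twice the second elementary symmetric function is `(∑ yᵢ)² - ∑ yᵢ²`. -/
theorem two_mul_sum_lt_mul {R ι : Type*} [CommRing R] [Fintype ι] [LinearOrder ι] (y : ι → R) :
    2 * ∑ p ∈ Finset.univ.filter (fun p : ι × ι => p.1 < p.2), y p.1 * y p.2
      = (∑ i, y i) * (∑ i, y i) - ∑ i, y i * y i := by
  have split : ∀ i j : ι, y i * y j = (if i < j then y i * y j else 0)
      + (if j < i then y j * y i else 0) + (if i = j then y i * y j else 0) := by
    intro i j
    rcases lt_trichotomy i j with h | h | h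
    · simp [h, h.ne, h.not_gt]
    · simp [h]
    · simp [h, h.ne', h.not_gt, mul_comm]
  rw [Finset.sum_filter, Fintype.sum_prod_type, Finset.sum_mul_sum]
  rw [Finset.sum_congr rfl fun i _ => Finset.sum_congr rfl fun j _ => split i j]
  simp only [Finset.sum_add_distrib]
  rw [Finset.sum_comm (f := fun i j => if j < i then y j * y i else 0)]
  simp
  ring

/-- The polar form of the second elementary symmetric function vanishes on any subspace
(the range of `Y`) on which that function vanishes. -/
theorem polar_eq_zero_of_sum_lt_mul_eq_zero {R ι M : Type*} [CommRing R] [IsDomain R] [Fintype ι]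
    [LinearOrder ι] [AddCommGroup M] [Module R M] (h2 : (2 : R) ≠ 0) (Y : M →ₗ[R] ι → R)
    (hY : ∀ x, ∑ p ∈ Finset.univ.filter (fun p : ι × ι => p.1 < p.2), Y x p.1 * Y x p.2 = 0)
    (v w : M) : (∑ i, Y v i) * (∑ i, Y w i) = ∑ i, Y v i * Y w i := by
  have hQ (x : M) : (∑ i, Y x i) * (∑ i, Y x i) - ∑ i, Y x i * Y x i = 0 := by
    rw [← two_mul_sum_lt_mul, hY, mul_zero]
  have hvw := hQ (v + w)
  simp only [map_add, Pi.add_apply, add_mul, mul_add, Finset.sum_add_distrib] at hvw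
  simp only [fun i => mul_comm (Y w i) (Y v i)] at hvw
  refine mul_left_cancel₀ h2 ?_
  linear_combination hvw - hQ v - hQ w

/-- If `F` has characteristic different from 2 and the image of `k` in `F` is not `-1`,
then for any `k - 1` homogeneous linear forms `ℓ_1, …, ℓ_{k-1}` in `X_1, …, X_{k+1}`, the
polynomial `S_{2k}^2(X_1, …, X_{k+1}, ℓ_1, …, ℓ_{k-1})` is nonzero. -/
theorem stmt_17 (F : Type*) [Field F] (hchar : (2 : F) ≠ 0)
    (k : ℕ) (hk : 1 ≤ k) (hkF : (k : F) ≠ -1)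
    (ℓ : Fin (k - 1) → Fin (k + 1) → F) :
    aeval (fun i : Fin (2 * k) =>
        if h' : (i : ℕ) < k + 1 then (X ⟨i, h'⟩ : MvPolynomial (Fin (k + 1)) F)
        else ∑ m : Fin (k + 1),
          C (ℓ ⟨(i : ℕ) - (k + 1), by have := i.isLt; omega⟩ m) * X m)
      (esym2 F (2 * k)) ≠ 0 := by
  intro h0
  let Y : (Fin (k + 1) → F) →ₗ[F] Fin (2 * k) → F := LinearMap.pi fun i =>
    if h' : (i : ℕ) < k + 1 then LinearMap.proj ⟨i, h'⟩
    else ∑ m : Fin (k + 1), ℓ ⟨(i : ℕ) - (k + 1), by have := i.isLt; omega⟩ m • LinearMap.proj m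
  have hY_lt (x) (i : Fin (2 * k)) (h' : (i : ℕ) < k + 1) : Y x i = x ⟨i, h'⟩ := by
    simp only [Y, LinearMap.pi_apply, dif_pos h', LinearMap.proj_apply]
  have hY (x) : ∑ p ∈ Finset.univ.filter (fun p : Fin (2 * k) × Fin (2 * k) => p.1 < p.2),
      Y x p.1 * Y x p.2 = 0 := by
    have h1 := congrArg (eval x) h0
    simp only [esym2, map_sum, map_mul, aeval_X, map_zero] at h1
    rw [← h1]
    have hev (i : Fin (2 * k)) : Y x i = eval x (if h' : (i : ℕ) < k + 1
        then (X ⟨i, h'⟩ : MvPolynomial (Fin (k + 1)) F)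
        else ∑ m : Fin (k + 1),
          C (ℓ ⟨(i : ℕ) - (k + 1), by have := i.isLt; omega⟩ m) * X m) := by
      by_cases h' : (i : ℕ) < k + 1
      · rw [hY_lt _ _ h', dif_pos h', eval_X]
      · simp only [Y, LinearMap.pi_apply, dif_neg h']
        simp
    simp only [hev]
  -- `k` linear conditions on `k + 1` coordinates: `∑ Y v = 0` and all linear forms vanish at `v`.
  let T : (Fin (k + 1) → F) →ₗ[F] F × (Fin (k - 1) → F) :=
    ((∑ i, LinearMap.proj i) ∘ₗ Y).prod
      (LinearMap.pi fun j => LinearMap.proj ⟨k + 1 + j, by have := j.isLt; omega⟩ ∘ₗ Y)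
  obtain ⟨v, hvT, hv⟩ := (Submodule.ne_bot_iff _).1
    (LinearMap.ker_ne_bot_of_finrank_lt (f := T) (by simp; omega))
  have hsum : ∑ i, Y v i = 0 := by
    simpa [T] using congrArg Prod.fst (LinearMap.mem_ker.1 hvT)
  have htail (i : Fin (2 * k)) (hi : ¬ (i : ℕ) < k + 1) : Y v i = 0 := by
    have h1 := congrFun (congrArg Prod.snd (LinearMap.mem_ker.1 hvT))
      ⟨(i : ℕ) - (k + 1), by have := i.isLt; omega⟩
    have hidx : k + 1 + ((i : ℕ) - (k + 1)) = i := by omega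
    change Y v ⟨k + 1 + ((i : ℕ) - (k + 1)), _⟩ = 0 at h1
    simpa only [hidx] using h1
  obtain ⟨a, ha⟩ := Function.ne_iff.1 hv
  have hpol := polar_eq_zero_of_sum_lt_mul_eq_zero hchar Y hY v (Pi.single a 1)
  have ha_lt : (a : ℕ) < 2 * k := by have := a.isLt; omega
  rw [hsum, zero_mul, Finset.sum_eq_single ⟨a, ha_lt⟩, hY_lt _ _ a.isLt, hY_lt _ _ a.isLt] at hpol
  · exact ha (by simpa using hpol.symm)
  · intro i _ hia
    by_cases hi : (i : ℕ) < k + 1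
    · have hne : (⟨i, hi⟩ : Fin (k + 1)) ≠ a := by simpa [Fin.ext_iff] using hia
      rw [hY_lt _ i hi, hY_lt _ i hi, Pi.single_eq_of_ne hne, mul_zero]
    · rw [htail i hi, zero_mul]
  · simp
end

section
/- Let F be a field of characteristic different from 2 and let k ≥ 1. Then for any k − 1 homogeneous linear forms ℓ_1,…,ℓ_{k-1} in the variables X_1,…,X_{k+1} over F, the polynomial S_{2k}^2(X_1,…,X_{k+1}, ℓ_1,…,ℓ_{k-1}) is not the zero polynomial. -/
open MvPolynomial

/-- Twice the value of `esym2` is the square of the sum minus the sum of the squares. -/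
theorem two_mul_aeval_esym2 {F A : Type*} [CommRing F] [CommRing A] [Algebra F A] {n : ℕ}
    (a : Fin n → A) :
    2 * aeval a (esym2 F n) = (∑ i, a i) ^ 2 - ∑ i, a i ^ 2 := by
  have hlt : aeval a (esym2 F n) = ∑ i, ∑ j, if i < j then a i * a j else 0 := by
    simp [esym2, Finset.sum_filter, Fintype.sum_prod_type, apply_ite (aeval a)]
  have hgt : aeval a (esym2 F n) = ∑ i, ∑ j, if j < i then a i * a j else 0 := by
    rw [hlt, Finset.sum_comm]
    simp only [mul_comm]
  have hdiag : ∑ i, a i ^ 2 = ∑ i, ∑ j, if i = j then a i * a j else 0 := by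
    simp [sq]
  rw [two_mul, eq_sub_iff_add_eq, hdiag]
  nth_rewrite 1 [hlt]
  rw [hgt, sq, Finset.sum_mul_sum]
  simp only [← Finset.sum_add_distrib]
  refine Finset.sum_congr rfl fun i _ => Finset.sum_congr rfl fun j _ => ?_
  rcases lt_trichotomy i j with h | h | h
  · simp [h, h.ne, h.not_gt]
  · simp [h]
  · simp [h, h.ne', h.not_gt]

/-- If the sum of squares and the square of the sum of the coordinates agree along a linear map
`v`, then any `x` with `∑ i, v x i = 0` is orthogonal to everything in the range of `v`. -/
theorem sum_mul_eq_zero_of_sq_sum_eq {F E ι : Type*} [Field F] (hchar : (2 : F) ≠ 0)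
    [AddCommGroup E] [Module F E] [Fintype ι] (v : E →ₗ[F] ι → F)
    (h : ∀ z, (∑ i, v z i) ^ 2 = ∑ i, v z i ^ 2) {x : E} (hx : ∑ i, v x i = 0) (y : E) :
    ∑ i, v x i * v y i = 0 := by
  have hxy := h (x + y)
  simp only [map_add, Pi.add_apply, add_sq, Finset.sum_add_distrib, hx, ← h x, ← h y, mul_assoc,
    ← Finset.mul_sum] at hxy
  refine (mul_eq_zero.mp ?_).resolve_left hchar
  linear_combination -hxy

/-- If `F` has characteristic different from 2, then for any `k - 1` homogeneous linear
forms `ℓ_1, …, ℓ_{k-1}` in `X_1, …, X_{k+1}`, the polynomial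
`S_{2k}^2(X_1, …, X_{k+1}, ℓ_1, …, ℓ_{k-1})` is nonzero. -/
theorem stmt_19 (F : Type*) [Field F] (hchar : (2 : F) ≠ 0)
    (k : ℕ) (hk : 1 ≤ k)
    (ℓ : Fin (k - 1) → Fin (k + 1) → F) :
    aeval (fun i : Fin (2 * k) =>
        if h' : (i : ℕ) < k + 1 then (X ⟨i, h'⟩ : MvPolynomial (Fin (k + 1)) F)
        else ∑ m : Fin (k + 1),
          C (ℓ ⟨(i : ℕ) - (k + 1), by have := i.isLt; omega⟩ m) * X m)
      (esym2 F (2 * k)) ≠ 0 := by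
  intro hzero
  let lin : Fin (k - 1) → (Fin (k + 1) → F) →ₗ[F] F := fun i => ∑ m, ℓ i m • LinearMap.proj m
  let v : (Fin (k + 1) → F) →ₗ[F] Fin (2 * k) → F := LinearMap.pi fun i =>
    if h' : (i : ℕ) < k + 1 then LinearMap.proj ⟨i, h'⟩
    else lin ⟨(i : ℕ) - (k + 1), by have := i.isLt; omega⟩
  have hvar : ∀ z (i : Fin (2 * k)) (h' : (i : ℕ) < k + 1), v z i = z ⟨i, h'⟩ := by
    intro z i h'
    simp only [v, LinearMap.pi_apply, dif_pos h', LinearMap.proj_apply]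
  have hform : ∀ z (i : Fin (2 * k)) (h' : ¬ (i : ℕ) < k + 1),
      v z i = lin ⟨(i : ℕ) - (k + 1), by have := i.isLt; omega⟩ z := by
    intro z i h'
    simp only [v, LinearMap.pi_apply, dif_neg h']
  have hv : ∀ z, (∑ i, v z i) ^ 2 = ∑ i, v z i ^ 2 := by
    intro z
    have h := congrArg (aeval z) ((two_mul_aeval_esym2 _).symm.trans
      ((congrArg (2 * ·) hzero).trans (mul_zero 2)))
    have hcoord : ∀ i : Fin (2 * k), aeval z
        (if h' : (i : ℕ) < k + 1 then (X ⟨i, h'⟩ : MvPolynomial (Fin (k + 1)) F)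
        else ∑ m : Fin (k + 1),
          C (ℓ ⟨(i : ℕ) - (k + 1), by have := i.isLt; omega⟩ m) * X m) = v z i := by
      intro i
      by_cases h' : (i : ℕ) < k + 1
      · rw [dif_pos h', hvar z i h', aeval_X]
      · rw [dif_neg h', hform z i h']
        simp [lin]
    simp only [map_sub, map_pow, map_sum, hcoord, map_zero] at h
    exact sub_eq_zero.mp h
  -- The `k - 1` forms and the coordinate sum are `k` linear conditions on a space of dimension
  -- `k + 1`, so they have a common nontrivial zero.
  let T : (Fin (k + 1) → F) →ₗ[F] (Fin (k - 1) → F) × F :=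
    (LinearMap.pi lin).prod (∑ i, LinearMap.proj i ∘ₗ v)
  obtain ⟨x, hxT, hx0⟩ := (Submodule.ne_bot_iff _).mp
    (LinearMap.ker_ne_bot_of_finrank_lt (f := T) (by simp; omega))
  have hT : (∀ i, lin i x = 0) ∧ ∑ i, v x i = 0 := by
    simpa [T, _root_.funext_iff] using hxT
  refine hx0 (funext fun m => ?_)
  have horth := sum_mul_eq_zero_of_sq_sum_eq hchar v hv hT.2 (Pi.single m 1)
  rw [Finset.sum_eq_single ⟨m, by omega⟩ ?_ (by simp)] at horth
  · simpa [hvar _ ⟨m, _⟩ m.isLt] using horth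
  · intro i _ hi
    by_cases h' : (i : ℕ) < k + 1
    · have him : (⟨i, h'⟩ : Fin (k + 1)) ≠ m := by
        rintro rfl
        exact hi rfl
      simp [hvar _ i h', him]
    · rw [hform x i h', hT.1, zero_mul]
end
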